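/- arXiv:1910.12458 — 8 statements merged into one kernel-verified Lean document; each statement's English description precedes it below -/
import Mathlib

section
/- For every prime p and positive integer k there exists N such that every non-degenerate Boolean function f : {0,1}^n → {0,1} with n ≥ N satisfies deg_{p^k}(f) ≥ (p−1)·k. -/
/-- Hamming weight of a Boolean input. -/
def wt {n : ℕ} (x : Fin n → Bool) : ℕ :=
  (Finset.univ.filter fun i => x i = true).card

/-- Coefficient of the monomial `∏_{i ∈ S} x_i` in the unique multilinear polynomial over
`ℤ_m` representing the Boolean function `f`, obtained by Möbius inversion. -/
def modCoeff (m n : ℕ) (f : (Fin n → Bool) → Bool) (S : Finset (Fin n)) : ZMod m :=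
  ∑ T ∈ S.powerset, (-1 : ZMod m) ^ (S.card - T.card) * (if f (fun i => decide (i ∈ T)) then 1 else 0)

/-- The modulo-`m` degree of a Boolean function: the total degree of the unique multilinear
polynomial over `ℤ_m` representing it. -/
def modDeg (m n : ℕ) (f : (Fin n → Bool) → Bool) : ℕ :=
  ((Finset.univ : Finset (Finset (Fin n))).filter fun S => modCoeff m n f S ≠ 0).sup Finset.card

/-- A Boolean function is symmetric if its value depends only on the Hamming weight. -/
def SymmetricBF {n : ℕ} (f : (Fin n → Bool) → Bool) : Prop :=
  ∀ x y, wt x = wt y → f x = f y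

/-- A Boolean function is non-trivial if it is not constant. -/
def NontrivialBF {n : ℕ} (f : (Fin n → Bool) → Bool) : Prop :=
  ∃ x y, f x ≠ f y

/-- A symmetric Boolean function is `ℓ`-periodic if its univariate version takes equal values
on arguments that agree modulo `ℓ`. -/
def PeriodicBF {n : ℕ} (ℓ : ℕ) (f : (Fin n → Bool) → Bool) : Prop :=
  ∀ x y : Fin n → Bool, wt x % ℓ = wt y % ℓ → f x = f y

/-- A Boolean function is non-degenerate if every coordinate is sensitive on some input. -/
def NondegenerateBF {n : ℕ} (f : (Fin n → Bool) → Bool) : Prop :=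
  ∀ i : Fin n, ∃ x, f x ≠ f (Function.update x i (!x i))

open Polynomial in
/-- Modulo `X ^ p - 1`, the polynomial `(X - 1) ^ ((p - 1) * k)` is `p ^ k` times an integer
polynomial, up to a multiple of `1 + X + ⋯ + X ^ (p - 1)` that is not divisible by `p ^ k`. -/
theorem exists_X_sub_one_pow_eq {p : ℕ} (hp : p.Prime) (k : ℕ) :
    ∃ u v : ℤ[X], (X - 1 : ℤ[X]) ^ ((p - 1) * (k + 1)) =
      C ((p : ℤ) ^ (k + 1)) * u + C ((-1) ^ k * (p : ℤ) ^ k) * (∑ i ∈ Finset.range p, X ^ i)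
        + v * (X ^ p - 1) := by
  set S : ℤ[X] := ∑ i ∈ Finset.range p, X ^ i with hS
  have hp0 : (p : ℤ) ≠ 0 := by exact_mod_cast hp.ne_zero
  have hSX : S * (X - 1) = X ^ p - 1 := geom_sum_mul X p
  have hX : (X - 1 : ℤ[X]) ≠ 0 := X_sub_C_ne_zero (1 : ℤ)
  obtain ⟨s, rfl⟩ : ∃ s, p = s + 2 := ⟨p - 2, by have := hp.two_le; omega⟩
  have hS1 : S.eval 1 = ((s + 2 : ℕ) : ℤ) := by simp [hS, eval_finsetSum]
  simp only [show s + 2 - 1 = s + 1 from rfl]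
  obtain ⟨r, hr⟩ := exists_add_pow_prime_eq hp (X - 1 : ℤ[X]) 1
  have hbase : (X - 1 : ℤ[X]) ^ (s + 1) = S - C ((s + 2 : ℕ) : ℤ) * r := by
    apply mul_right_cancel₀ hX
    have : C ((s + 2 : ℕ) : ℤ) = ((s + 2 : ℕ) : ℤ[X]) := by simp
    rw [sub_mul, hSX, this]
    rw [sub_add_cancel] at hr
    rw [hr]
    ring
  induction k with
  | zero => exact ⟨-r, 0, by simp only [zero_add, mul_one, hbase, pow_one, pow_zero, C_1]; ring⟩
  | succ k ih =>
    obtain ⟨u, v, h⟩ := ih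
    have hu : u.eval 1 = (-1) ^ (k + 1) := by
      have h1 := congrArg (eval 1) h
      simp only [eval_add, eval_mul, eval_C, hS1, eval_pow, eval_sub, eval_X, eval_one,
        sub_self, one_pow, mul_zero, add_zero] at h1
      rw [zero_pow (by positivity)] at h1
      apply mul_left_cancel₀ (pow_ne_zero (k + 1) hp0)
      linear_combination -h1
    obtain ⟨w, hw⟩ : (X - 1 : ℤ[X]) ∣ u - C ((-1) ^ (k + 1)) := by
      rw [← C_1, dvd_iff_isRoot]
      simp [hu]
    have hw' : u = C ((-1) ^ (k + 1)) + (X - 1) * w := by rw [← hw]; ring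
    refine ⟨-(u * r), C (((s + 2 : ℕ) : ℤ) ^ (k + 1)) * w + v * (X - 1) ^ (s + 1)
      + C ((-1) ^ k * ((s + 2 : ℕ) : ℤ) ^ k) * (X - 1) ^ s, ?_⟩
    have hSb : S * (X - 1 : ℤ[X]) ^ (s + 1) = (X ^ (s + 2) - 1) * (X - 1) ^ s := by
      rw [← hSX]; ring
    have huS : u * S = C ((-1) ^ (k + 1)) * S + w * (X ^ (s + 2) - 1) := by
      rw [← hSX]; nth_rewrite 1 [hw']; ring
    have e : (X - 1 : ℤ[X]) ^ ((s + 1) * (k + 1 + 1)) =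
      (X - 1) ^ ((s + 1) * (k + 1)) * (X - 1) ^ (s + 1) := by ring
    rw [e, h]
    simp only [map_mul, map_pow] at *
    linear_combination (C ((s + 2 : ℕ) : ℤ)) ^ (k + 1) * u * hbase
      + (C (-1)) ^ k * (C ((s + 2 : ℕ) : ℤ)) ^ k * hSb
      + (C ((s + 2 : ℕ) : ℤ)) ^ (k + 1) * huS

/-- The shift operator on integer sequences. -/
def seqShift : Module.End ℤ (ℕ → ℤ) := LinearMap.funLeft ℤ ℤ (· + 1)

theorem seqShift_pow_apply (i : ℕ) (g : ℕ → ℤ) (y : ℕ) : (seqShift ^ i) g y = g (y + i) := by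
  induction i generalizing g with
  | zero => simp
  | succ i ih =>
    rw [pow_succ, Module.End.mul_apply, ih]
    simp [seqShift, LinearMap.funLeft, add_assoc]

open Polynomial in
theorem aeval_seqShift_dvd {m : ℤ} {g : ℕ → ℤ} (h : ∀ y, m ∣ g y) (P : ℤ[X]) (y : ℕ) :
    m ∣ aeval seqShift P g y := by
  choose g' hg' using h
  obtain rfl : g = m • g' := funext hg'
  rw [map_smul]
  exact ⟨_, rfl⟩

open Polynomial in
theorem aeval_seqShift_affine (P : ℤ[X]) (g : ℕ → ℤ) (c b y : ℕ) :
    aeval seqShift P (fun z => g (c * z + b)) y =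
      aeval seqShift (expand ℤ c P) g (c * y + b) := by
  induction P using Polynomial.induction_on' with
  | add P Q hP hQ => simp [hP, hQ]
  | monomial i a =>
    simp only [expand_monomial, aeval_monomial, Module.End.mul_apply, Module.algebraMap_end_apply,
      Pi.smul_apply, seqShift_pow_apply]
    congr 2
    ring

open Polynomial in
/-- Differencing `D` times modulo `m` annihilates a sequence sampled along an arithmetic
progression when it annihilates the sequence itself. -/
theorem dvd_diff_affine {m : ℤ} {g : ℕ → ℤ} {D : ℕ}
    (h : ∀ y, m ∣ aeval seqShift ((X - 1 : ℤ[X]) ^ D) g y) (c b y : ℕ) :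
    m ∣ aeval seqShift ((X - 1 : ℤ[X]) ^ D) (fun z => g (c * z + b)) y := by
  rw [aeval_seqShift_affine]
  obtain ⟨Q, hQ⟩ : (X - 1 : ℤ[X]) ^ D ∣ expand ℤ c ((X - 1 : ℤ[X]) ^ D) := by
    rw [map_pow, map_sub, expand_X, map_one]
    exact pow_dvd_pow_of_dvd (sub_one_dvd_pow_sub_one _ _) _
  rw [hQ, mul_comm, map_mul, Module.End.mul_apply]
  exact aeval_seqShift_dvd h _ _

open Polynomial in
theorem const_of_periodic_prime {p : ℕ} (hp : p.Prime) {k : ℕ} (hk : 0 < k) {g : ℕ → ℤ}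
    (h01 : ∀ y, g y = 0 ∨ g y = 1)
    (h : ∀ y, (p : ℤ) ^ k ∣ aeval seqShift ((X - 1 : ℤ[X]) ^ ((p - 1) * k)) g y)
    (hper : ∀ y, g (y + p) = g y) (y : ℕ) : g (y + 1) = g y := by
  obtain ⟨k, rfl⟩ : ∃ j, k = j + 1 := ⟨k - 1, by omega⟩
  obtain ⟨u, v, huv⟩ := exists_X_sub_one_pow_eq hp k
  have hker : aeval seqShift (X ^ p - 1 : ℤ[X]) g = 0 := by
    ext z
    simp [seqShift_pow_apply, hper]
  have h1 : aeval seqShift ((X - 1 : ℤ[X]) ^ ((p - 1) * (k + 1))) g y =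
      (p : ℤ) ^ (k + 1) * aeval seqShift u g y
        + (-1) ^ k * (p : ℤ) ^ k * ∑ i ∈ Finset.range p, g (y + i) := by
    rw [huv, map_add, LinearMap.add_apply, map_mul (aeval seqShift) v, Module.End.mul_apply, hker,
      map_zero, add_zero, map_add, map_mul, map_mul, aeval_C, aeval_C, map_sum]
    simp only [LinearMap.add_apply, Pi.add_apply, Module.End.mul_apply,
      Module.algebraMap_end_apply, Pi.smul_apply, smul_eq_mul, LinearMap.sum_apply,
      Finset.sum_apply, map_pow (aeval seqShift), aeval_X, seqShift_pow_apply]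
  have hsum : (p : ℤ) ∣ ∑ i ∈ Finset.range p, g (y + i) := by
    have h2 := h y
    rw [h1, dvd_add_right (dvd_mul_right _ _), mul_assoc,
      (isUnit_neg_one.pow k).dvd_mul_left, pow_succ] at h2
    exact (mul_dvd_mul_iff_left (pow_ne_zero k (by exact_mod_cast hp.ne_zero))).1 h2
  have h0 : 0 ∈ Finset.range p := Finset.mem_range.2 hp.pos
  have h1' : 1 ∈ Finset.range p := Finset.mem_range.2 hp.one_lt
  have hnn : ∀ i ∈ Finset.range p, 0 ≤ g (y + i) := fun i _ => by
    rcases h01 (y + i) with h | h <;> omega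
  have hle : ∀ i ∈ Finset.range p, g (y + i) ≤ 1 := fun i _ => by
    rcases h01 (y + i) with h | h <;> omega
  rcases (Finset.sum_nonneg hnn).eq_or_lt with hz | hpos
  · have := (Finset.sum_eq_zero_iff_of_nonneg hnn).1 hz.symm
    have e0 := this 0 h0
    rw [add_zero] at e0
    rw [e0, this 1 h1']
  · have hge := Int.le_of_dvd hpos hsum
    have hcard : ∑ i ∈ Finset.range p, (1 : ℤ) = p := by simp
    have := (Finset.sum_eq_sum_iff_of_le hle).1
      (le_antisymm (Finset.sum_le_sum hle) (hcard ▸ hge))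
    have e0 := this 0 h0
    have e1 := this 1 h1'
    rw [add_zero] at e0
    rw [e0, e1]

open Polynomial in
theorem eq_succ_of_dvd_diff {p : ℕ} (hp : p.Prime) {k : ℕ} (hk : 0 < k) {g : ℕ → ℤ}
    (h01 : ∀ y, g y = 0 ∨ g y = 1)
    (h : ∀ y, (p : ℤ) ^ k ∣ aeval seqShift ((X - 1 : ℤ[X]) ^ ((p - 1) * k)) g y) (y : ℕ) :
    g (y + 1) = g y := by
  have hper : ∃ t, ∀ z, g (z + p ^ t) = g z := by
    refine ⟨(p - 1) * k, fun z => ?_⟩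
    obtain ⟨r, hr⟩ := exists_add_pow_prime_pow_eq hp (X - 1 : ℤ[X]) 1 ((p - 1) * k)
    obtain ⟨Q, hQ⟩ : (X - 1 : ℤ[X]) ^ ((p - 1) * k) ∣ (X - 1) ^ p ^ ((p - 1) * k) :=
      pow_dvd_pow _ (Nat.lt_pow_self hp.one_lt).le
    have hd : (X ^ p ^ ((p - 1) * k) - 1 : ℤ[X]) =
        Q * (X - 1) ^ ((p - 1) * k) + C (p : ℤ) * ((X - 1) * r) := by
      rw [sub_add_cancel, hQ] at hr
      rw [hr]
      simp
      ring
    have h1 : (p : ℤ) ∣ aeval seqShift (X ^ p ^ ((p - 1) * k) - 1 : ℤ[X]) g z := by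
      rw [hd, map_add, LinearMap.add_apply, map_mul, map_mul, Module.End.mul_apply,
        Module.End.mul_apply, aeval_C, Module.algebraMap_end_apply]
      exact dvd_add (aeval_seqShift_dvd (fun y => (dvd_pow_self _ hk.ne').trans (h y)) _ _)
        ⟨_, rfl⟩
    rw [map_sub, map_pow, aeval_X, map_one, LinearMap.sub_apply, Pi.sub_apply,
      seqShift_pow_apply, Module.End.one_apply] at h1
    have hp2 : (2 : ℤ) ≤ p := by exact_mod_cast hp.two_le
    have := Int.eq_zero_of_abs_lt_dvd h1 (by
      rw [abs_lt]
      rcases h01 (z + p ^ ((p - 1) * k)) with e | e <;> rcases h01 z with e' | e' <;>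
        rw [e, e'] <;> constructor <;> omega)
    omega
  obtain ⟨t, ht⟩ := hper
  induction t with
  | zero => simpa using ht y
  | succ t ih =>
    apply ih
    intro b
    have := const_of_periodic_prime hp hk (g := fun z => g (p ^ t * z + b)) (fun z => h01 _)
      (fun z => dvd_diff_affine h _ _ _) (fun z => ?_) 0
    · simpa [add_comm] using this
    · rw [← ht (p ^ t * z + b)]
      ring_nf

/-- Every large enough indexed family of sets of bounded size contains a sunflower: `m` members
that are pairwise disjoint outside a common kernel. -/
theorem exists_sunflower (d m : ℕ) : ∃ N : ℕ, ∀ {ι α : Type} [DecidableEq ι] [DecidableEq α]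
    (I : Finset ι) (A : ι → Finset α), (∀ i ∈ I, (A i).card ≤ d) → N ≤ I.card →
      ∃ J ⊆ I, m ≤ J.card ∧ ∃ K : Finset α, K.card ≤ d ∧ (∀ i ∈ J, K ⊆ A i) ∧
        ∀ i ∈ J, ∀ j ∈ J, i ≠ j → Disjoint (A i \ K) (A j \ K) := by
  induction d with
  | zero =>
    refine ⟨m, fun I A hA hI => ⟨I, subset_rfl, hI, ∅, by simp, by simp, fun i hi j _ _ => ?_⟩⟩
    rw [Finset.card_eq_zero.1 (Nat.le_zero.1 (hA i hi))]
    simp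
  | succ d ih =>
    obtain ⟨N, hN⟩ := ih
    refine ⟨m + m * (d + 1) * N + 1, fun {ι α} _ _ I A hA hI => ?_⟩
    let P : Finset ι → Prop := fun J => ∀ i ∈ J, ∀ j ∈ J, i ≠ j → Disjoint (A i) (A j)
    classical
    obtain ⟨J, hJ, hmax⟩ := (I.powerset.filter P).exists_max_image Finset.card
      ⟨∅, by simp [P]⟩
    simp only [Finset.mem_filter, Finset.mem_powerset] at hJ hmax
    obtain ⟨hJI, hJP⟩ := hJ
    by_cases hm : m ≤ J.card
    · exact ⟨J, hJI, hm, ∅, by simp, by simp, by simpa [P] using hJP⟩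
    set V := J.biUnion A with hV
    have hVc : V.card ≤ m * (d + 1) :=
      (Finset.card_biUnion_le_card_mul _ _ _ fun i hi => hA i (hJI hi)).trans
        (Nat.mul_le_mul_right _ (by omega))
    have hmeet : ∀ i ∈ I \ J, ∃ v, v ∈ V ∧ v ∈ A i := by
      intro i hi
      rw [Finset.mem_sdiff] at hi
      by_contra! hcon
      have hd : ∀ j ∈ J, Disjoint (A i) (A j) := fun j hj =>
        Finset.disjoint_left.2 fun v hv hv' => hcon v (Finset.mem_biUnion.2 ⟨j, hj, hv'⟩) hv
      have := hmax (insert i J) ⟨Finset.insert_subset hi.1 hJI, by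
        intro a ha b hb hab
        rw [Finset.mem_insert] at ha hb
        rcases ha with rfl | ha <;> rcases hb with rfl | hb
        · exact absurd rfl hab
        · exact hd b hb
        · exact (hd a ha).symm
        · exact hJP a ha b hb hab⟩
      rw [Finset.card_insert_of_notMem hi.2] at this
      omega
    have hcard : m * (d + 1) * N < (I \ J).card := by
      have := Finset.le_card_sdiff J I
      omega
    obtain ⟨i₀, hi₀⟩ := Finset.card_pos.1 (Nat.zero_lt_of_lt hcard)
    have : Nonempty α := ⟨(hmeet i₀ hi₀).choose⟩
    choose! v hvV hvA using hmeet
    obtain ⟨w, -, hw⟩ := Finset.exists_lt_card_fiber_of_mul_lt_card_of_maps_to (n := N) hvV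
      ((Nat.mul_le_mul_right N hVc).trans_lt hcard)
    set I' := (I \ J).filter fun i => v i = w
    have hI' : ∀ i ∈ I', i ∈ I ∧ w ∈ A i := fun i hi => by
      obtain ⟨h1, rfl⟩ := Finset.mem_filter.1 hi
      exact ⟨(Finset.mem_sdiff.1 h1).1, hvA i h1⟩
    obtain ⟨J', hJ', hmJ, K, hKd, hK, hdis⟩ := hN I' (fun i => (A i).erase w) (fun i hi => by
      have := hA i (hI' i hi).1
      rw [Finset.card_erase_of_mem (hI' i hi).2]
      omega) hw.le
    refine ⟨J', fun i hi => (hI' i (hJ' hi)).1, hmJ, insert w K,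
      (Finset.card_insert_le _ _).trans (by omega), fun i hi => ?_, fun i hi j hj hij => ?_⟩
    · exact Finset.insert_subset (hI' i (hJ' hi)).2 ((hK i hi).trans (Finset.erase_subset _ _))
    · have := hdis i hi j hj hij
      rwa [Finset.erase_sdiff_comm, Finset.erase_sdiff_comm, ← Finset.sdiff_insert,
        ← Finset.sdiff_insert] at this

/-- The coefficient at `S` of the multilinear polynomial representing `F`. -/
def mobiusCoeff {R α : Type*} [CommRing R] (F : Finset α → R) (S : Finset α) : R :=
  ∑ T ∈ S.powerset, (-1) ^ (S.card - T.card) * F T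

theorem mobiusCoeff_insert {R α : Type*} [CommRing R] [DecidableEq α] (F : Finset α → R)
    {a : α} {S : Finset α} (ha : a ∉ S) :
    mobiusCoeff F (insert a S) =
      ∑ T ∈ S.powerset, (-1) ^ (S.card - T.card) * (F (insert a T) - F T) := by
  rw [mobiusCoeff, Finset.sum_powerset_insert ha, ← Finset.sum_add_distrib]
  refine Finset.sum_congr rfl fun T hT => ?_
  rw [Finset.mem_powerset] at hT
  have hle := Finset.card_le_card hT
  rw [Finset.card_insert_of_notMem ha, Finset.card_insert_of_notMem fun h => ha (hT h),
    Nat.add_sub_add_right, Nat.sub_add_comm hle, pow_succ]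
  ring

theorem sum_mobiusCoeff {R α : Type*} [CommRing R] [DecidableEq α] (F : Finset α → R)
    (S : Finset α) : ∑ T ∈ S.powerset, mobiusCoeff F T = F S := by
  induction S using Finset.induction_on generalizing F with
  | empty => simp [mobiusCoeff]
  | insert a S ha ih =>
    rw [Finset.sum_powerset_insert ha, ← Finset.sum_add_distrib, ← ih fun T => F (insert a T)]
    refine Finset.sum_congr rfl fun T hT => ?_
    rw [mobiusCoeff_insert F fun h => ha (Finset.mem_powerset.1 hT h)]
    simp only [mobiusCoeff, mul_sub, Finset.sum_sub_distrib]
    ring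

theorem sum_powerset_neg_one_pow_eq_zero {R α : Type*} [CommRing R] [DecidableEq α]
    {H : Finset α → R} {S : Finset α} {x : α} (hx : x ∈ S)
    (h : ∀ T, H (insert x T) = H T) : ∑ T ∈ S.powerset, (-1) ^ T.card * H T = 0 := by
  rw [← Finset.insert_erase hx, Finset.sum_powerset_insert (Finset.notMem_erase x S),
    ← Finset.sum_add_distrib]
  refine Finset.sum_eq_zero fun T hT => ?_
  rw [h, Finset.card_insert_of_notMem fun hT' =>
    Finset.notMem_erase x S (Finset.mem_powerset.1 hT hT'), pow_succ]
  ring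

/-- All `D`-fold finite differences of `h` vanish modulo `q`. -/
def DiffsVanish (q D : ℕ) (h : Finset ℕ → Bool) : Prop :=
  ∀ S B : Finset ℕ, S.card = D →
    ∑ T ∈ S.powerset, (-1 : ZMod q) ^ T.card * (if h (T ∪ B) then 1 else 0) = 0

/-- Fixing variables to `1` on `K` and identifying variables within disjoint blocks does not raise
the degree. -/
theorem diffsVanish_blocks {α : Type*} [DecidableEq α] {q D : ℕ} {F : Finset α → Bool}
    (hF : ∀ S : Finset α, D ≤ S.card →
      mobiusCoeff (fun T => if F T then (1 : ZMod q) else 0) S = 0)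
    (K : Finset α) (Q : ℕ → Finset α) (hQ : ∀ i j, i ≠ j → Disjoint (Q i) (Q j)) :
    DiffsVanish q D fun Y => F (K ∪ Y.biUnion Q) := by
  intro S B hS
  set U := K ∪ (S ∪ B).biUnion Q with hU
  have hexp : ∀ T ∈ S.powerset, (if F (K ∪ (T ∪ B).biUnion Q) then (1 : ZMod q) else 0) =
      ∑ A ∈ U.powerset, mobiusCoeff (fun T => if F T then (1 : ZMod q) else 0) A *
        (if A ⊆ K ∪ (T ∪ B).biUnion Q then 1 else 0) := by
    intro T hT
    have hsub : K ∪ (T ∪ B).biUnion Q ⊆ U := Finset.union_subset_union subset_rfl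
      (Finset.biUnion_subset_biUnion_of_subset_left _
        (Finset.union_subset_union (Finset.mem_powerset.1 hT) subset_rfl))
    rw [← sum_mobiusCoeff (fun T => if F T then (1 : ZMod q) else 0)]
    simp only [mul_ite, mul_one, mul_zero, ← Finset.sum_filter]
    refine Finset.sum_congr ?_ fun _ _ => rfl
    ext A
    simp only [Finset.mem_powerset, Finset.mem_filter]
    exact ⟨fun h => ⟨h.trans hsub, h⟩, fun h => h.2⟩
  rw [Finset.sum_congr rfl fun T hT => by rw [hexp T hT, Finset.mul_sum], Finset.sum_comm]
  refine Finset.sum_eq_zero fun A _ => ?_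
  by_cases hA : D ≤ A.card
  · simp [hF A hA]
  obtain ⟨x, hxS, hx⟩ : ∃ x ∈ S, Disjoint A (Q x) := by
    by_contra! hcon
    have hne : ∀ x ∈ S, ∃ a, a ∈ A ∧ a ∈ Q x := fun x hx => Finset.not_disjoint_iff.1 (hcon x hx)
    obtain ⟨x₀, hx₀⟩ : S.Nonempty := Finset.card_pos.1 (by omega)
    have : Nonempty α := ⟨(hne x₀ hx₀).choose⟩
    choose! a haA haQ using hne
    have := Finset.card_le_card_of_injOn a haA fun x hx y hy hxy => by
      by_contra! hne
      exact Finset.disjoint_left.1 (hQ x y hne) (haQ x hx) (hxy ▸ haQ y hy)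
    omega
  simp_rw [mul_left_comm _ (mobiusCoeff _ A), ← Finset.mul_sum]
  rw [sum_powerset_neg_one_pow_eq_zero hxS, mul_zero]
  intro T
  congr 1
  rw [Finset.insert_union, Finset.biUnion_insert, Finset.union_left_comm, eq_iff_iff]
  exact ⟨fun h => hx.left_le_of_le_sup_left h, fun h => h.trans Finset.subset_union_right⟩

open Filter in
/-- A limit of set functions along a nonprincipal ultrafilter, agreeing with infinitely many of
them on any given finite collection of sets. -/
theorem exists_ultralimit (h : ℕ → Finset ℕ → Bool) :
    ∃ F : Finset ℕ → Bool, ∀ S, ∀ᶠ m in (hyperfilter ℕ : Filter ℕ), h m S = F S := by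
  classical
  refine ⟨fun S => decide (∀ᶠ m in (hyperfilter ℕ : Filter ℕ), h m S = true), fun S => ?_⟩
  by_cases hS : ∀ᶠ m in (hyperfilter ℕ : Filter ℕ), h m S = true
  · simp [hS]
  · simpa [hS] using Ultrafilter.eventually_not.2 hS

/-- The iterated limit of `F` along `j` fresh elements added to the argument. -/
noncomputable def iterLimit (F : Finset ℕ → Bool) : ℕ → Finset ℕ → Bool
  | 0, S => F S
  | j + 1, S => (exists_ultralimit fun i S => iterLimit F j (insert i S)).choose S

open Filter in
theorem iterLimit_eventually (F : Finset ℕ → Bool) (j : ℕ) (S : Finset ℕ) :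
    ∀ᶠ i in (hyperfilter ℕ : Filter ℕ), iterLimit F j (insert i S) = iterLimit F (j + 1) S :=
  (exists_ultralimit fun i S => iterLimit F j (insert i S)).choose_spec S

open Filter in
/-- A set function on the naturals is symmetric on some subset of any prescribed finite size. -/
theorem exists_symmetric_subset (F : Finset ℕ → Bool) (r J : ℕ) :
    ∃ M : Finset ℕ, M.card = r ∧ ∀ S ⊆ M, ∀ j ≤ J,
      iterLimit F j S = iterLimit F (j + S.card) ∅ := by
  induction r generalizing J with
  | zero => exact ⟨∅, rfl, fun S hS j _ => by simp [Finset.subset_empty.1 hS]⟩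
  | succ r ih =>
    obtain ⟨M, hM, h⟩ := ih (J + 1)
    have h1 : ∀ᶠ i in (hyperfilter ℕ : Filter ℕ), ∀ S ∈ M.powerset, ∀ j ∈ Finset.range (J + 1),
        iterLimit F j (insert i S) = iterLimit F (j + 1) S := by
      simp only [eventually_all_finset]
      exact fun S _ j _ => iterLimit_eventually F j S
    have h2 : ∀ᶠ i in (hyperfilter ℕ : Filter ℕ), i ∉ M := by
      exact M.finite_toSet.compl_mem_hyperfilter
    obtain ⟨i, hi, hiM⟩ := (h1.and h2).exists
    refine ⟨insert i M, by rw [Finset.card_insert_of_notMem hiM, hM], fun S hS j hj => ?_⟩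
    by_cases hiS : i ∈ S
    · have hS' : S.erase i ⊆ M := Finset.subset_insert_iff.1 hS
      have := hi (S.erase i) (Finset.mem_powerset.2 hS') j (Finset.mem_range.2 (by omega))
      rw [Finset.insert_erase hiS] at this
      rw [this, h _ hS' (j + 1) (by omega), ← Finset.card_erase_add_one hiS]
      congr 1
      ring
    · exact h S ((Finset.subset_insert_iff_of_notMem hiS).1 hS) j (by omega)

open Polynomial in
theorem dvd_diff_iterLimit {q D : ℕ} {F : Finset ℕ → Bool} (hF : DiffsVanish q D F) (y : ℕ) :
    (q : ℤ) ∣ aeval seqShift ((X - 1 : ℤ[X]) ^ D)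
      (fun j => if iterLimit F j ∅ then 1 else 0) y := by
  obtain ⟨M, hM, hsym⟩ := exists_symmetric_subset F (y + D) 0
  obtain ⟨S, hSM, hS⟩ := Finset.exists_subset_card_eq (show D ≤ M.card by omega)
  set g : ℕ → ℤ := fun j => if iterLimit F j ∅ then 1 else 0 with hg
  have hexp : aeval seqShift ((X - 1 : ℤ[X]) ^ D) g y =
      (-1) ^ D * ∑ j ∈ Finset.range (D + 1), D.choose j • ((-1) ^ j * g (y + j)) := by
    rw [sub_eq_add_neg, add_pow, map_sum, LinearMap.sum_apply, Finset.sum_apply, Finset.mul_sum]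
    refine Finset.sum_congr rfl fun j hj => ?_
    have hj' : j ≤ D := Nat.lt_succ_iff.1 (Finset.mem_range.1 hj)
    have hsign : ((-1 : ℤ)) ^ (D - j) = (-1) ^ D * (-1) ^ j := by
      obtain ⟨e, rfl⟩ := Nat.exists_eq_add_of_le hj'
      rw [Nat.add_sub_cancel_left, pow_add]
      have hsq : (-1 : ℤ) ^ j * (-1) ^ j = 1 := by rw [← mul_pow]; simp
      linear_combination -(-1 : ℤ) ^ e * hsq
    have : (X ^ j * (-1) ^ (D - j) * (D.choose j : ℤ[X]) : ℤ[X]) =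
        C ((-1) ^ D * (-1) ^ j * (D.choose j : ℤ)) * X ^ j := by
      rw [← hsign]
      simp
      ring
    rw [this, map_mul, map_pow, aeval_X, aeval_C, Module.End.mul_apply,
      Module.algebraMap_end_apply, Pi.smul_apply, seqShift_pow_apply, smul_eq_mul, nsmul_eq_mul]
    ring
  rw [hexp, ← hS, ← Finset.sum_powerset_apply_card (fun j => (-1) ^ j * g (y + j)),
    (isUnit_neg_one.pow _).dvd_mul_left, ← ZMod.intCast_zmod_eq_zero_iff_dvd, Int.cast_sum,
    ← hF S (M \ S) hS]
  refine Finset.sum_congr rfl fun T hT => ?_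
  rw [Finset.mem_powerset] at hT
  have hTc : (T ∪ M \ S).card = y + T.card := by
    rw [Finset.card_union_of_disjoint (Finset.disjoint_sdiff.mono_left hT),
      Finset.card_sdiff_of_subset hSM]
    omega
  have := hsym (T ∪ M \ S) (Finset.union_subset (hT.trans hSM) Finset.sdiff_subset) 0 le_rfl
  rw [zero_add, hTc] at this
  simp only [iterLimit] at this
  simp [hg, this]

open Filter in
/-- No family of Boolean set functions with vanishing `(p - 1) * k`-fold differences modulo `p ^ k`
has unboundedly many sensitive singletons. -/
theorem exists_bound_sensitive_singletons {p k : ℕ} (hp : p.Prime) (hk : 0 < k) :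
    ∃ m : ℕ, ∀ h : Finset ℕ → Bool, DiffsVanish (p ^ k) ((p - 1) * k) h →
      ∃ i < m, h {i} = h ∅ := by
  by_contra! hcon
  choose h hv hs using hcon
  obtain ⟨F, hF⟩ := exists_ultralimit h
  have hFv : DiffsVanish (p ^ k) ((p - 1) * k) F := by
    intro S B hS
    have hev : ∀ᶠ m in (hyperfilter ℕ : Filter ℕ), ∀ T ∈ S.powerset, h m (T ∪ B) = F (T ∪ B) := by
      rw [eventually_all_finset]
      exact fun T _ => hF _
    obtain ⟨m, hm⟩ := hev.exists
    refine (Finset.sum_congr rfl fun T hT => ?_).trans (hv m S B hS)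
    rw [hm T hT]
  have hFs : ∀ i, F {i} ≠ F ∅ := by
    intro i
    have hlt : ∀ᶠ m in (hyperfilter ℕ : Filter ℕ), i < m :=
      Nat.hyperfilter_le_atTop (eventually_gt_atTop i)
    obtain ⟨m, ⟨h1, h2⟩, h3⟩ := (((hF {i}).and (hF ∅)).and hlt).exists
    rw [← h1, ← h2]
    exact hs m i h3
  have hne : iterLimit F 1 ∅ ≠ iterLimit F 0 ∅ := by
    obtain ⟨i, hi⟩ := (iterLimit_eventually F 0 ∅).exists
    rw [← hi]
    exact hFs i
  have := eq_succ_of_dvd_diff hp hk (g := fun j => if iterLimit F j ∅ then 1 else 0)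
    (fun y => by split_ifs <;> simp)
    (fun y => by simpa using dvd_diff_iterLimit hFv y) 0
  apply hne
  simp only [zero_add] at this
  revert this
  cases iterLimit F 1 ∅ <;> cases iterLimit F 0 ∅ <;> simp

/-- A function with a sensitive coordinate `i` and low degree is sensitive to `i` near `∅`. -/
theorem exists_sensitive_set {α : Type*} [DecidableEq α] {q D : ℕ} {F : Finset α → Bool}
    (hF : ∀ S : Finset α, D ≤ S.card →
      mobiusCoeff (fun T => if F T then (1 : ZMod q) else 0) S = 0)
    (hq : (1 : ZMod q) ≠ 0) {i : α} {Z : Finset α} (hi : i ∉ Z) (hZ : F (insert i Z) ≠ F Z) :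
    ∃ A : Finset α, A.card ≤ D ∧ i ∈ A ∧ F A ≠ F (A.erase i) := by
  set G : Finset α → ZMod q := fun T => if F T then 1 else 0 with hG
  have hne : ∑ S ∈ Z.powerset, mobiusCoeff G (insert i S) ≠ 0 := by
    intro h0
    have h1 := sum_mobiusCoeff G (insert i Z)
    rw [Finset.sum_powerset_insert hi, h0, add_zero, sum_mobiusCoeff] at h1
    revert h1 hZ
    simp only [hG]
    cases F (insert i Z) <;> cases F Z <;> simp [hq, hq.symm]
  obtain ⟨S, hS, hSne⟩ := Finset.exists_ne_zero_of_sum_ne_zero hne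
  have hiS : i ∉ S := fun h => hi (Finset.mem_powerset.1 hS h)
  have hcard : (insert i S).card < D := by
    by_contra! hc
    exact hSne (hF _ hc)
  rw [mobiusCoeff_insert G hiS] at hSne
  obtain ⟨T, hT, hTne⟩ := Finset.exists_ne_zero_of_sum_ne_zero hSne
  rw [Finset.mem_powerset] at hT
  refine ⟨insert i T, (Finset.card_le_card (Finset.insert_subset_insert i hT)).trans hcard.le,
    Finset.mem_insert_self _ _, fun h => hTne ?_⟩
  rw [Finset.erase_insert fun h => hiS (hT h)] at h
  simp [hG, h]

/-- A function with many sensitive sets of bounded size has, after fixing and identifying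
variables, many sensitive singletons. -/
theorem exists_sensitive_blocks (D m : ℕ) : ∃ N : ℕ, ∀ {α : Type} [Fintype α] [DecidableEq α]
    (F : Finset α → Bool),
    (∀ i, ∃ A : Finset α, A.card ≤ D ∧ i ∈ A ∧ F A ≠ F (A.erase i)) → N ≤ Fintype.card α →
      ∃ (K : Finset α) (Q : ℕ → Finset α), (∀ i j, i ≠ j → Disjoint (Q i) (Q j)) ∧
        ∀ i < m, F (K ∪ Q i) ≠ F K := by
  obtain ⟨N, hN⟩ := exists_sunflower D (m + D)
  refine ⟨N, fun {α} _ _ F hF hcard => ?_⟩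
  choose A hAD hiA hA using hF
  obtain ⟨J, -, hJ, K, hKD, hK, hdis⟩ := hN Finset.univ A (fun i _ => hAD i) (by simpa)
  have hJK : m ≤ (J \ K).card := by
    have := Finset.le_card_sdiff K J
    omega
  obtain ⟨J', hJ', hJm⟩ := Finset.exists_subset_card_eq hJK
  have hblock : ∀ i ∈ J', ∃ B ⊆ A i \ K, F (K ∪ B) ≠ F K := by
    intro i hi
    obtain ⟨hiJ, hiK⟩ := Finset.mem_sdiff.1 (hJ' hi)
    by_contra! hcon
    apply hA i
    have h1 := hcon (A i \ K) subset_rfl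
    have h2 := hcon ((A i).erase i \ K)
      (Finset.sdiff_subset_sdiff (Finset.erase_subset _ _) subset_rfl)
    have hKe : K ⊆ (A i).erase i := fun x hx =>
      Finset.mem_erase.2 ⟨fun h => hiK (h ▸ hx), hK i hiJ hx⟩
    rw [Finset.union_sdiff_of_subset (hK i hiJ)] at h1
    rw [Finset.union_sdiff_of_subset hKe] at h2
    rw [h1, h2]
  choose! B hBA hB using hblock
  let e := J'.equivFinOfCardEq hJm
  refine ⟨K, fun j => if hj : j < m then B (e.symm ⟨j, hj⟩) else ∅, fun i j hij => ?_,
    fun i hi => ?_⟩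
  · by_cases hi : i < m
    · by_cases hj : j < m
      · simp only [hi, hj, dite_true]
        have hmem : ∀ a : J', (a : α) ∈ J := fun a => (Finset.mem_sdiff.1 (hJ' a.2)).1
        refine (hdis _ (hmem _) _ (hmem _) fun h => hij ?_).mono
          (hBA _ (e.symm ⟨i, hi⟩).2) (hBA _ (e.symm ⟨j, hj⟩).2)
        simpa using e.symm.injective (Subtype.ext h)
      · simp [hj]
    · simp [hi]
  · simp only [hi, dite_true]
    exact hB _ (e.symm ⟨i, hi⟩).2

/-- For every prime `p` and `k ≥ 1` there is `N` such that every
non-degenerate Boolean function on `n ≥ N` variables has `deg_{p^k}(f) ≥ (p−1)k`. -/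
theorem stmt1 (p k : ℕ) (hp : p.Prime) (hk : 0 < k) :
    ∃ N : ℕ, ∀ n : ℕ, N ≤ n → ∀ f : (Fin n → Bool) → Bool, NondegenerateBF f →
      (p - 1) * k ≤ modDeg (p ^ k) n f := by
  obtain ⟨m, hm⟩ := exists_bound_sensitive_singletons hp hk
  obtain ⟨N, hN⟩ := exists_sensitive_blocks ((p - 1) * k) m
  refine ⟨N, fun n hn f hf => ?_⟩
  by_contra! hlt
  set F : Finset (Fin n) → Bool := fun T => f fun i => decide (i ∈ T) with hFdef
  have hF : ∀ S : Finset (Fin n), (p - 1) * k ≤ S.card →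
      mobiusCoeff (fun T => if F T then (1 : ZMod (p ^ k)) else 0) S = 0 := by
    intro S hS
    by_contra hne
    have : S.card ≤ modDeg (p ^ k) n f :=
      Finset.le_sup (f := Finset.card) (Finset.mem_filter.2 ⟨Finset.mem_univ S, hne⟩)
    omega
  have : Fact (1 < p ^ k) := ⟨Nat.one_lt_pow hk.ne' hp.one_lt⟩
  have hsens : ∀ i, ∃ A : Finset (Fin n), A.card ≤ (p - 1) * k ∧ i ∈ A ∧ F A ≠ F (A.erase i) := by
    intro i
    obtain ⟨x, hx⟩ := hf i
    set Z : Finset (Fin n) := Finset.univ.filter fun j => j ≠ i ∧ x j = true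
    refine exists_sensitive_set hF one_ne_zero (i := i) (Z := Z) (by simp [Z]) ?_
    have h1 : (fun j => decide (j ∈ insert i Z)) = Function.update x i true := by
      ext j
      by_cases hj : j = i
      · subst hj; simp
      · simp [Z, hj]
    have h0 : (fun j => decide (j ∈ Z)) = Function.update x i false := by
      ext j
      by_cases hj : j = i
      · subst hj; simp [Z]
      · simp [Z, hj]
    simp only [hFdef, h1, h0]
    have hself := Function.update_eq_self i x
    cases hxi : x i <;> rw [hxi] at hx hself
    · rw [hself]; simpa using hx.symm
    · rw [hself]; simpa using hx
  obtain ⟨K, Q, hQ, hKQ⟩ := hN F hsens (by simpa using hn)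
  obtain ⟨i, hi, h⟩ := hm _ (diffsVanish_blocks hF K Q hQ)
  exact hKQ i hi (by simpa using h)
end

section
/- Let m be a composite number having at least two distinct prime factors p and q. Then every non-trivial symmetric Boolean function f : {0,1}^n → {0,1} satisfies deg_m(f) ≥ n / (2 + 1/(p−1) + 1/(q−1)). -/
open scoped fwdDiff in
theorem fwdDiff_iter_zero_fun {R : Type*} [CommRing R] (N : ℕ) :
    Δ_[1] ^[N] (0 : ℕ → R) = 0 := by
  exact Function.iterate_fixed (by funext x; simp [fwdDiff]) N

open scoped fwdDiff in
theorem fwdDiff_iter_eq_zero_of_le {R : Type*} [CommRing R] {f : ℕ → R} {a N : ℕ}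
    (hf : Δ_[1] ^[a] f = 0) (h : a ≤ N) : Δ_[1] ^[N] f = 0 := by
  obtain ⟨k, rfl⟩ := Nat.exists_eq_add_of_le' h
  rw [Function.iterate_add_apply, hf, fwdDiff_iter_zero_fun]

open scoped fwdDiff in
theorem fwdDiff_iter_mul_eq_zero {R : Type*} [CommRing R] {f g : ℕ → R} {a b N : ℕ}
    (hf : Δ_[1] ^[a] f = 0) (hg : Δ_[1] ^[b] g = 0) (h : a + b ≤ N + 1) :
    Δ_[1] ^[N] (f * g) = 0 := by
  induction N generalizing f g a b with
  | zero =>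
    rcases Nat.eq_zero_or_pos a with rfl | ha
    · have : f = 0 := hf
      simp [this]
    · obtain rfl : b = 0 := by omega
      have : g = 0 := hg
      simp [this]
  | succ N ih =>
    rcases a with _ | a
    · have : f = 0 := hf
      rw [this, zero_mul, fwdDiff_iter_zero_fun]
    rcases b with _ | b
    · have : g = 0 := hg
      rw [this, mul_zero, fwdDiff_iter_zero_fun]
    rw [Function.iterate_succ_apply, ← smul_eq_mul, fwdDiff_smul, fwdDiff_iter_add,
      fwdDiff_iter_add]
    simp only [smul_eq_mul]
    rw [ih (a := a) (b := b + 1) hf hg (by omega), ih (a := a + 1) (b := b) hf hg (by omega),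
      ih (a := a) (b := b) hf hg (by omega)]
    simp

open Finset in
open scoped fwdDiff in
/-- A function annihilated by the `k`-th difference operator is determined by its first `k`
values. -/
theorem eq_zero_of_fwdDiff_iter_eq_zero {R : Type*} [CommRing R] {f : ℕ → R} {k : ℕ}
    (hf : Δ_[1] ^[k] f = 0) (h0 : ∀ x < k, f x = 0) : f = 0 := by
  funext x
  have key := shift_eq_sum_fwdDiff_iter 1 f x 0
  simp only [smul_eq_mul, mul_one, zero_add] at key
  rw [key]
  refine sum_eq_zero fun j _ ↦ ?_
  rcases lt_or_ge j k with hj | hj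
  · rw [fwdDiff_iter_eq_sum_shift, sum_eq_zero, smul_zero]
    intro i hi
    rw [h0 _ (by simp at hi ⊢; omega), smul_zero]
  · rw [fwdDiff_iter_eq_zero_of_le hf hj, Pi.zero_apply, smul_zero]

open scoped fwdDiff in
theorem fwdDiff_iter_choose_mul_eq_zero {R : Type*} [CommRing R] (c : R) {k N : ℕ} (h : k < N) :
    Δ_[1] ^[N] (fun x : ℕ ↦ (x.choose k : R) * c) = 0 := by
  induction N generalizing k with
  | zero => omega
  | succ N ih =>
    rw [Function.iterate_succ_apply]
    rcases k with _ | k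
    · have : Δ_[1] (fun x : ℕ ↦ (x.choose 0 : R) * c) = 0 := by
        funext x; simp [fwdDiff]
      rw [this, fwdDiff_iter_zero_fun]
    · have : Δ_[1] (fun x : ℕ ↦ (x.choose (k + 1) : R) * c) = fun x ↦ (x.choose k : R) * c := by
        funext x
        simp only [fwdDiff, Nat.choose_succ_succ', Nat.cast_add]
        ring
      rw [this, ih (by omega)]

open Finset in
open scoped fwdDiff in
/-- If the Newton coefficients of `g` of orders in `(d, n]` vanish, then `g` agrees on `[0, n]` with
a function of degree at most `d`. -/
theorem exists_extension_of_fwdDiff_iter_eq_zero {R : Type*} [CommRing R] {g : ℕ → R} {d n : ℕ}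
    (hg : ∀ k, d < k → k ≤ n → Δ_[1] ^[k] g 0 = 0) :
    ∃ P : ℕ → R, Δ_[1] ^[d + 1] P = 0 ∧ ∀ x ≤ n, P x = g x := by
  refine ⟨∑ k ∈ range (d + 1), fun x ↦ (x.choose k : R) * Δ_[1] ^[k] g 0, ?_, fun x hx ↦ ?_⟩
  · rw [fwdDiff_iter_finsetSum]
    exact sum_eq_zero fun k hk ↦ fwdDiff_iter_choose_mul_eq_zero _ (mem_range.mp hk)
  · have key := shift_eq_sum_fwdDiff_iter 1 g x 0
    simp only [smul_eq_mul, mul_one, zero_add, nsmul_eq_mul] at key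
    rw [key, Finset.sum_apply]
    rcases le_total d x with h | h
    · refine sum_subset (range_subset_range.mpr (by omega)) fun k hk hk' ↦ ?_
      simp only [mem_range] at hk hk'
      rw [hg k (by omega) (by omega), mul_zero]
    · symm
      refine sum_subset (range_subset_range.mpr (by omega)) fun k hk hk' ↦ ?_
      simp only [mem_range] at hk hk'
      rw [Nat.choose_eq_zero_of_lt (by omega), Nat.cast_zero, zero_mul]

open Polynomial Finset in
theorem X_sub_one_pow_eq_sum (p : ℕ) [Fact p.Prime] (a : ℕ) :
    (X - 1 : (ZMod p)[X]) ^ ((p - 1) * p ^ a) = ∑ i ∈ range p, X ^ (i * p ^ a) := by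
  have hp := Fact.out (p := p.Prime)
  have h1 : (X - 1 : (ZMod p)[X]) ^ p ^ a ≠ 0 := pow_ne_zero _ (X_sub_C_ne_zero (1 : ZMod p))
  apply mul_right_cancel₀ h1
  rw [← pow_add, ← Nat.succ_mul, Nat.succ_eq_add_one, Nat.sub_add_cancel hp.one_le,
    ← pow_succ', sub_pow_char_pow, sub_pow_char_pow, one_pow, one_pow]
  simp_rw [mul_comm _ (p ^ a), pow_mul]
  rw [geom_sum_mul, ← pow_mul, pow_succ]

open Finset in
open scoped fwdDiff in
theorem sum_shift_eq_zero_of_fwdDiff_iter_eq_zero {p : ℕ} [Fact p.Prime] {a : ℕ} {P : ℕ → ZMod p}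
    (hP : Δ_[1] ^[(p - 1) * p ^ a] P = 0) (x : ℕ) :
    ∑ i ∈ range p, P (x + i * p ^ a) = 0 := by
  let E : Module.End (ZMod p) (ℕ → ZMod p) := LinearMap.funLeft _ _ (· + 1)
  have hE : ∀ k f y, (E ^ k) f y = f (y + k) := by
    intro k
    induction k with
    | zero => simp
    | succ k ih =>
      intro f y
      rw [pow_succ, Module.End.mul_apply, ih]
      simp [E, LinearMap.funLeft_apply, add_assoc]
  have hD : ∀ k f, ((E - 1) ^ k) f = Δ_[1] ^[k] f := by
    intro k
    induction k with
    | zero => simp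
    | succ k ih =>
      intro f
      rw [pow_succ, Module.End.mul_apply, ih, Function.iterate_succ_apply]
      rfl
  have key := congrArg (fun Q ↦ Polynomial.aeval E Q P x) (X_sub_one_pow_eq_sum p a)
  simp only [map_pow, map_sub, Polynomial.aeval_X, map_one, map_sum, hD, hP, LinearMap.sum_apply,
    Finset.sum_apply, hE, Pi.zero_apply] at key
  exact key.symm

open Finset in
open scoped fwdDiff in
/-- A `{0, 1}`-valued function on `ℕ` of degree less than `(p - 1) p ^ a` modulo `p` is
`p ^ a`-periodic. -/
theorem periodic_of_fwdDiff_iter_eq_zero {p : ℕ} [Fact p.Prime] {a : ℕ} {P : ℕ → ZMod p}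
    (hP : Δ_[1] ^[(p - 1) * p ^ a] P = 0) (h01 : ∀ x, P x = 0 ∨ P x = 1) (x : ℕ) :
    P (x + p ^ a) = P x := by
  have hp := Fact.out (p := p.Prime)
  have hsum := sum_shift_eq_zero_of_fwdDiff_iter_eq_zero hP x
  set s := (range p).filter fun i ↦ P (x + i * p ^ a) = 1
  have hcard : (s.card : ZMod p) = 0 := by
    rw [← hsum, card_filter, Nat.cast_sum]
    refine sum_congr rfl fun i _ ↦ ?_
    rcases h01 (x + i * p ^ a) with h | h <;> simp [h]
  have hle : s.card ≤ p := (card_filter_le _ _).trans_eq (card_range p)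
  have hdvd := (ZMod.natCast_eq_zero_iff _ _).mp hcard
  have h0 : 0 ∈ range p := mem_range.mpr hp.pos
  have h1 : 1 ∈ range p := mem_range.mpr hp.one_lt
  rcases Nat.eq_zero_or_pos s.card with h | h
  · have hz : ∀ i ∈ range p, P (x + i * p ^ a) = 0 := fun i hi ↦
      (h01 _).resolve_right (filter_eq_empty_iff.mp (card_eq_zero.mp h) hi)
    simpa using (hz 1 h1).trans (hz 0 h0).symm
  · have hs : s.card = (range p).card := by
      rw [card_range]; exact le_antisymm hle (Nat.le_of_dvd h hdvd)
    have hz : ∀ i ∈ range p, P (x + i * p ^ a) = 1 := card_filter_eq_iff.mp hs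
    simpa using (hz 1 h1).trans (hz 0 h0).symm

open Finset in
open scoped fwdDiff in
theorem periodicOn_of_fwdDiff_iter_eq_zero {p : ℕ} [Fact p.Prime] {a d n : ℕ} {F : ℕ → Bool}
    (hF : ∀ k, d < k → k ≤ n → Δ_[1] ^[k] (fun x ↦ if F x then (1 : ZMod p) else 0) 0 = 0)
    (hn : 2 * d ≤ n) (ha : d < (p - 1) * p ^ a) {x : ℕ} (hx : x + p ^ a ≤ n) :
    F (x + p ^ a) = F x := by
  obtain ⟨P, hP, hPF⟩ := exists_extension_of_fwdDiff_iter_eq_zero hF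
  have hP1 : Δ_[1] ^[d + 1] (P - 1) = 0 := by
    have : Δ_[1] (P - 1) = Δ_[1] P := by funext x; simp [fwdDiff]
    rw [Function.iterate_succ_apply, this, ← Function.iterate_succ_apply, hP]
  have hzero : P * (P - 1) = 0 := by
    refine eq_zero_of_fwdDiff_iter_eq_zero
      (fwdDiff_iter_mul_eq_zero (N := 2 * d + 1) hP hP1 (by omega)) fun y hy ↦ ?_
    rw [Pi.mul_apply, Pi.sub_apply, hPF y (by omega)]
    cases F y <;> simp
  have h01 : ∀ y, P y = 0 ∨ P y = 1 := fun y ↦ by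
    simpa [sub_eq_zero] using congrFun hzero y
  have := periodic_of_fwdDiff_iter_eq_zero (fwdDiff_iter_eq_zero_of_le hP ha) h01 x
  rw [hPF _ hx, hPF x (by omega)] at this
  cases h1 : F (x + p ^ a) <;> cases h2 : F x <;> simp [h1, h2] at this ⊢

/-- A weak form of the Fine–Wilf theorem. -/
theorem eq_zero_value_of_coprime_periods {α : Type*} {F : ℕ → α} {s t n : ℕ} (hst : s.Coprime t)
    (hs : 0 < s) (hn : s + t ≤ n + 1) (hFs : ∀ x, x + s ≤ n → F (x + s) = F x)
    (hFt : ∀ x, x + t ≤ n → F (x + t) = F x) {x : ℕ} (hx : x ≤ n) : F x = F 0 := by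
  have hmod : ∀ y ≤ n, F y = F (y % s) := by
    intro y
    induction y using Nat.strong_induction_on with
    | _ y ih =>
      intro hy
      rcases lt_or_ge y s with h | h
      · rw [Nat.mod_eq_of_lt h]
      · obtain ⟨z, rfl⟩ := Nat.exists_eq_add_of_le' h
        rw [hFs z hy, ih z (by omega) (by omega), Nat.add_mod_right]
  have hmul : ∀ k, F (k * t % s) = F 0 := by
    intro k
    induction k with
    | zero => simp
    | succ k ih =>
      have hlt := Nat.mod_lt (k * t) hs
      rw [← ih, ← hFt (k * t % s) (by omega), hmod _ (by omega : k * t % s + t ≤ n),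
        Nat.mod_add_mod, Nat.succ_mul]
  obtain ⟨k, hk⟩ : ∃ k, k * t ≡ x [MOD s] := by
    obtain ⟨u, hu⟩ := Nat.exists_mul_mod_eq_of_coprime x hst.symm hs.ne'
    exact ⟨u, by rw [mul_comm]; exact hu.2⟩
  rw [hmod x hx, ← hk, hmul]

open Finset in
open scoped fwdDiff in
theorem fwdDiff_iter_eq_zero_of_modDeg_lt {m p n : ℕ} (hpm : p ∣ m) {f : (Fin n → Bool) → Bool}
    (F : ℕ → Bool) (hF : ∀ x, f x = F (wt x)) {k : ℕ} (hk : modDeg m n f < k) (hkn : k ≤ n) :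
    Δ_[1] ^[k] (fun x ↦ if F x then (1 : ZMod p) else 0) 0 = 0 := by
  obtain ⟨S, -, hS⟩ := exists_subset_card_eq (s := (univ : Finset (Fin n))) (n := k) (by simpa)
  have hcoeff : modCoeff m n f S = 0 := by
    by_contra h
    have : S.card ≤ modDeg m n f :=
      le_sup (f := Finset.card) (mem_filter.mpr ⟨mem_univ S, h⟩)
    exact absurd (hS ▸ this) (not_le.mpr hk)
  have hwt : ∀ T : Finset (Fin n), f (fun i ↦ decide (i ∈ T)) = F T.card := fun T ↦ by
    rw [hF]; simp [wt]
  have := congrArg (ZMod.castHom hpm (ZMod p)) hcoeff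
  simp only [modCoeff, hwt, map_zero] at this
  rw [sum_powerset_apply_card
    (fun j ↦ (-1 : ZMod m) ^ (S.card - j) * if F j then 1 else 0), hS, map_sum] at this
  rw [fwdDiff_iter_eq_sum_shift]
  refine (sum_congr rfl fun j _ ↦ ?_).trans this
  simp only [map_nsmul, map_mul, map_pow, map_neg, map_one, apply_ite (ZMod.castHom hpm (ZMod p)),
    map_zero]
  simp [mul_comm]

/-- The exponent of the period furnished by `periodicOn_of_fwdDiff_iter_eq_zero`. -/
theorem exists_pow_bound {p : ℕ} (hp : p.Prime) (d : ℕ) :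
    ∃ a, d < (p - 1) * p ^ a ∧ (a = 0 ∨ (p - 1) * p ^ a ≤ p * d) := by
  have hex : ∃ a, d < (p - 1) * p ^ a :=
    ⟨d, (Nat.lt_pow_self hp.one_lt).trans_le
      (Nat.le_mul_of_pos_left _ (Nat.sub_pos_of_lt hp.one_lt))⟩
  refine ⟨Nat.find hex, Nat.find_spec hex, ?_⟩
  rcases h : Nat.find hex with _ | a
  · exact Or.inl rfl
  · have := Nat.find_min hex (m := a) (by omega)
    right
    rw [pow_succ, ← mul_assoc, mul_comm]
    exact Nat.mul_le_mul_left p (not_lt.mp this)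

/-- If `m` is composite with two distinct prime factors `p, q`, then every
non-trivial symmetric Boolean function satisfies `deg_m(f) ≥ n / (2 + 1/(p−1) + 1/(q−1))`. -/
theorem stmt2 (m p q n : ℕ) (hm : 2 ≤ m) (hp : p.Prime) (hq : q.Prime) (hpq : p ≠ q)
    (hpm : p ∣ m) (hqm : q ∣ m)
    (f : (Fin n → Bool) → Bool) (hsym : SymmetricBF f) (hnt : NontrivialBF f) :
    (n : ℚ) / (2 + 1 / ((p : ℚ) - 1) + 1 / ((q : ℚ) - 1)) ≤ (modDeg m n f : ℚ) := by
  have : Fact p.Prime := ⟨hp⟩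
  have : Fact q.Prime := ⟨hq⟩
  have hp1 : (0 : ℚ) < (p : ℚ) - 1 := sub_pos.mpr (by exact_mod_cast hp.one_lt)
  have hq1 : (0 : ℚ) < (q : ℚ) - 1 := sub_pos.mpr (by exact_mod_cast hq.one_lt)
  rw [div_le_iff₀ (by positivity)]
  by_contra! hlt
  set d := modDeg m n f
  have hwt_le : ∀ x : Fin n → Bool, wt x ≤ n := fun x ↦
    (Finset.card_filter_le _ _).trans_eq (by simp)
  let F : ℕ → Bool := fun k ↦ f fun i ↦ decide ((i : ℕ) < k)
  have hF : ∀ x, f x = F (wt x) := fun x ↦ hsym _ _ <| by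
    rw [wt.eq_def fun i : Fin n ↦ decide ((i : ℕ) < wt x)]
    simp [Fin.card_filter_val_lt, hwt_le x]
  have h2d : 2 * d ≤ n := by
    have : (2 * d : ℚ) ≤ n := by
      refine le_trans ?_ hlt.le
      have h1 : 0 ≤ (d : ℚ) * (1 / ((p : ℚ) - 1)) := by positivity
      have h2 : 0 ≤ (d : ℚ) * (1 / ((q : ℚ) - 1)) := by positivity
      linarith
    exact_mod_cast this
  obtain ⟨a, hda, ha⟩ := exists_pow_bound hp d
  obtain ⟨b, hdb, hb⟩ := exists_pow_bound hq d
  have hperp : ∀ x, x + p ^ a ≤ n → F (x + p ^ a) = F x := fun x hx ↦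
    periodicOn_of_fwdDiff_iter_eq_zero (p := p)
      (fun _ ↦ fwdDiff_iter_eq_zero_of_modDeg_lt hpm F hF) h2d hda hx
  have hperq : ∀ x, x + q ^ b ≤ n → F (x + q ^ b) = F x := fun x hx ↦
    periodicOn_of_fwdDiff_iter_eq_zero (p := q)
      (fun _ ↦ fwdDiff_iter_eq_zero_of_modDeg_lt hqm F hF) h2d hdb hx
  have hconst : ∀ x ≤ n, F x = F 0 := by
    have hone : (∀ x, x + 1 ≤ n → F (x + 1) = F x) → ∀ x ≤ n, F x = F 0 := by
      intro h x hx
      induction x with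
      | zero => rfl
      | succ x ih => rw [h x hx, ih (by omega)]
    rcases ha with rfl | ha
    · exact hone (by simpa using hperp)
    rcases hb with rfl | hb
    · exact hone (by simpa using hperq)
    have hsum : p ^ a + q ^ b ≤ n := by
      have hpa : ((p : ℚ) ^ a) ≤ d * (1 + 1 / ((p : ℚ) - 1)) := by
        have : ((p - 1 : ℕ) * p ^ a : ℚ) ≤ p * d := by exact_mod_cast ha
        rw [Nat.cast_pred hp.pos] at this
        have h : (d : ℚ) * (1 + 1 / ((p : ℚ) - 1)) = p * d / ((p : ℚ) - 1) := by
          field_simp; ring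
        rw [h, le_div_iff₀ hp1]
        linarith
      have hqb : ((q : ℚ) ^ b) ≤ d * (1 + 1 / ((q : ℚ) - 1)) := by
        have : ((q - 1 : ℕ) * q ^ b : ℚ) ≤ q * d := by exact_mod_cast hb
        rw [Nat.cast_pred hq.pos] at this
        have h : (d : ℚ) * (1 + 1 / ((q : ℚ) - 1)) = q * d / ((q : ℚ) - 1) := by
          field_simp; ring
        rw [h, le_div_iff₀ hq1]
        linarith
      have : ((p : ℚ) ^ a + q ^ b) ≤ n := by linarith
      exact_mod_cast this
    intro x hx
    exact eq_zero_value_of_coprime_periods (Nat.coprime_pow_primes a b hp hq hpq)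
      (pow_pos hp.pos a) (by omega) hperp hperq hx
  obtain ⟨x, y, hxy⟩ := hnt
  exact hxy (by rw [hF, hF, hconst _ (hwt_le x), hconst _ (hwt_le y)])
end

section
/- Let m be a square-free composite number. For every ε > 0 there exist infinitely many n for which there is a non-trivial symmetric Boolean function f : {0,1}^n → {0,1} with deg_m(f) ≤ (1/2 + ε)·n. -/
/-- If `r < b < p ^ a`, then `p` divides `(p ^ a + r).choose b`. -/
lemma Nat.Prime.dvd_choose_pow_add {p a b r : ℕ} (hp : p.Prime) (hb : b < p ^ a) (hr : r < b) :
    p ∣ (p ^ a + r).choose b := by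
  rw [Nat.add_choose_eq]
  refine Finset.dvd_sum fun ij hij => ?_
  rw [Finset.HasAntidiagonal.mem_antidiagonal] at hij
  rcases Nat.eq_zero_or_pos ij.1 with h | h
  · rw [Nat.choose_eq_zero_of_lt (show r < ij.2 by omega), mul_zero]
    exact dvd_zero p
  · exact (hp.dvd_choose_pow (by omega) (by omega)).mul_right _

/-- The real numbers `k * v i` are, for suitable arbitrarily large `k`, simultaneously
arbitrarily close to integers. -/
lemma exists_nat_forall_abs_mul_sub_int_lt {ι : Type*} [Fintype ι] (v : ι → ℝ) {δ : ℝ}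
    (hδ : 0 < δ) (K : ℕ) :
    ∃ k : ℕ, K ≤ k ∧ ∀ i, ∃ z : ℤ, |k * v i - z| < δ := by
  have hbdd : Bornology.IsBounded (Set.Icc (0 : ι → ℝ) 1) := Metric.isBounded_Icc 0 1
  obtain ⟨w, -, φ, hφ, hlim⟩ := tendsto_subseq_of_bounded hbdd
    (x := fun (k : ℕ) i => Int.fract (k * v i))
    (fun k => ⟨fun i => Int.fract_nonneg _, fun i => (Int.fract_lt_one _).le⟩)
  obtain ⟨M, hM⟩ := Metric.cauchySeq_iff'.1 hlim.cauchySeq δ hδ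
  have hadd : φ M + K ≤ φ (M + K) := by
    clear hM
    induction K with
    | zero => simp
    | succ K ih => have := hφ (show M + K < M + (K + 1) by omega); omega
  refine ⟨φ (M + K) - φ M, by omega, fun i =>
    ⟨⌊(φ (M + K) : ℝ) * v i⌋ - ⌊(φ M : ℝ) * v i⌋, ?_⟩⟩
  have h := (dist_le_pi_dist _ _ i).trans_lt (hM (M + K) (by omega))
  simp only [Function.comp, Real.dist_eq, Int.fract] at h
  rw [Nat.cast_sub (by omega)]
  push_cast
  rw [show ((φ (M + K) : ℝ) - φ M) * v i - (⌊(φ (M + K) : ℝ) * v i⌋ - ⌊(φ M : ℝ) * v i⌋) =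
    φ (M + K) * v i - ⌊(φ (M + K) : ℝ) * v i⌋ - (φ M * v i - ⌊(φ M : ℝ) * v i⌋) by ring]
  exact h

/-- Finitely many integers greater than `1` have powers that are simultaneously arbitrarily large
and pairwise arbitrarily close on the multiplicative scale. -/
lemma exists_forall_pow_mem_Icc (s : Finset ℕ) (hs : ∀ p ∈ s, 1 < p) {ε : ℝ} (hε : 0 < ε) (M : ℝ) :
    ∃ X : ℝ, M ≤ X ∧ ∀ p ∈ s, ∃ a : ℕ, X ≤ p ^ a ∧ (p : ℝ) ^ a ≤ X * (1 + ε) := by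
  set η := Real.log (1 + ε) / 2 with hη
  have hη0 : 0 < η := half_pos (Real.log_pos (by linarith))
  have hexp : Real.exp (2 * η) = 1 + ε := by
    rw [hη, mul_div_cancel₀ _ two_ne_zero, Real.exp_log (by linarith)]
  set L : ℝ := 1 + ∑ p ∈ s, Real.log p with hL
  have hlog : ∀ p ∈ s, 0 < Real.log p := fun p hp => Real.log_pos (by exact_mod_cast hs p hp)
  have hL0 : 0 < L := by
    have := Finset.sum_nonneg fun p hp => (hlog p hp).le
    linarith
  have hlogL : ∀ p ∈ s, Real.log p ≤ L := fun p hp => by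
    have := Finset.single_le_sum (fun q hq => (hlog q hq).le) hp
    linarith
  obtain ⟨k, hk, hz⟩ := exists_nat_forall_abs_mul_sub_int_lt
    (fun p : s => (Real.log (p : ℕ))⁻¹) (div_pos hη0 hL0) ⌈|M| + η⌉₊
  have hkM : |M| + η ≤ k := (Nat.le_ceil _).trans (by exact_mod_cast hk)
  refine ⟨Real.exp (k - η), ?_, fun p hp => ?_⟩
  · have := Real.add_one_le_exp ((k : ℝ) - η)
    have := le_abs_self M
    linarith
  obtain ⟨z, hz⟩ := hz ⟨p, hp⟩
  have hlp := hlog p hp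
  have hclose : |k - z * Real.log p| < η := by
    have h1 : (k : ℝ) - z * Real.log p = (k * (Real.log p)⁻¹ - z) * Real.log p := by
      field_simp
    rw [h1, abs_mul, abs_of_pos hlp]
    calc _ < η / L * Real.log p := mul_lt_mul_of_pos_right hz hlp
      _ ≤ η / L * L := mul_le_mul_of_nonneg_left (hlogL p hp) (by positivity)
      _ = η := div_mul_cancel₀ _ hL0.ne'
  rw [abs_lt] at hclose
  have hz0 : 0 < z := by
    have h : 0 < (z : ℝ) * Real.log p := by
      have := abs_nonneg M
      linarith
    exact_mod_cast (pos_iff_pos_of_mul_pos h).2 hlp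
  lift z to ℕ using hz0.le
  have hpow : (p : ℝ) ^ z = Real.exp (z * Real.log p) := by
    have hp0 : (0 : ℝ) < p := by exact_mod_cast zero_lt_one.trans (hs p hp)
    rw [Real.exp_nat_mul, Real.exp_log hp0]
  rw [Int.cast_natCast] at hclose
  refine ⟨z, ?_, ?_⟩
  · rw [hpow]
    exact Real.exp_le_exp.2 (by linarith)
  · rw [hpow, ← hexp, ← Real.exp_add]
    exact Real.exp_le_exp.2 (by linarith)

lemma wt_decide_mem {n : ℕ} (T : Finset (Fin n)) : wt (fun i => decide (i ∈ T)) = T.card := by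
  simp [wt]

/-- Coefficients of the threshold function `x ↦ [|x| ≤ b]`. -/
lemma modCoeff_threshold (m : ℕ) {n b k : ℕ} (S : Finset (Fin n)) (hS : S.card = k + 1)
    (hb : b ≤ k) :
    modCoeff m n (fun x => decide (wt x ≤ b)) S =
      (((-1) ^ (k + 1) * ((-1) ^ b * k.choose b) : ℤ) : ZMod m) := by
  have h := Finset.sum_powerset_apply_card
    (fun j => (-1 : ZMod m) ^ (S.card - j) * (if j ≤ b then 1 else 0)) (x := S)
  simp only [modCoeff, wt_decide_mem, decide_eq_true_eq]
  rw [h, hS, ← Int.alternating_sum_range_choose_eq_choose, Finset.mul_sum, Int.cast_sum]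
  symm
  refine Finset.sum_subset_zero_on_sdiff (Finset.range_mono (by omega)) (fun j hj => ?_)
    (fun j hj => ?_)
  · have : ¬ j ≤ b := by
      simp only [Finset.mem_sdiff, Finset.mem_range] at hj
      omega
    simp [this]
  · rw [Finset.mem_range] at hj
    obtain ⟨d, hd⟩ : ∃ d, k + 1 = j + d := ⟨k + 1 - j, by omega⟩
    have hsq : ((-1 : ZMod m) ^ j) * (-1) ^ j = 1 := by
      rw [← mul_pow]
      simp
    rw [hd, if_pos (by omega), Nat.add_sub_cancel_left, nsmul_eq_mul, pow_add]
    push_cast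
    linear_combination (-1 : ZMod m) ^ d * ((j + d).choose j : ZMod m) * hsq

/-- For a square-free composite `m` and any `ε > 0`, there are infinitely many
`n` carrying a non-trivial symmetric Boolean function of modulo-`m` degree at most
`(1/2 + ε)·n`. -/
theorem stmt3 (m : ℕ) (hsf : Squarefree m) (hm : 2 ≤ m) (hnp : ¬ m.Prime)
    (ε : ℝ) (hε : 0 < ε) (N : ℕ) :
    ∃ n : ℕ, N ≤ n ∧ ∃ f : (Fin n → Bool) → Bool, SymmetricBF f ∧ NontrivialBF f ∧
      (modDeg m n f : ℝ) ≤ (1 / 2 + ε) * n := by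
  obtain ⟨X, hXM, hX⟩ := exists_forall_pow_mem_Icc m.primeFactors
    (fun p hp => (Nat.prime_of_mem_primeFactors hp).one_lt) hε (max (N + 1) (3 / ε + 6))
  have hXN : (N : ℝ) + 1 ≤ X := (le_max_left _ _).trans hXM
  have hXε : 3 / ε + 6 ≤ X := (le_max_right _ _).trans hXM
  have hX1 : 1 ≤ X := le_trans (by linarith [Nat.cast_nonneg (α := ℝ) N]) hXN
  obtain ⟨b, hb⟩ : ∃ b, ⌊X⌋₊ = b + 1 :=
    Nat.exists_eq_succ_of_ne_zero (Nat.floor_pos.2 hX1).ne'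
  have hbX : (b : ℝ) + 1 ≤ X := by
    have := Nat.floor_le (zero_le_one.trans hX1)
    rw [hb] at this
    exact_mod_cast this
  have hXb : X < b + 2 := by
    have := Nat.lt_floor_add_one X
    rw [hb] at this
    push_cast at this
    linarith
  refine ⟨2 * b + 1, ?_, fun x => decide (wt x ≤ b), ?_, ?_, ?_⟩
  · have : (N : ℝ) < b + 1 := by linarith
    have : N < b + 1 := by exact_mod_cast this
    omega
  · intro x y hxy
    simp only [hxy]
  · refine ⟨fun _ => false, fun _ => true, ?_⟩
    have h1 : wt (fun _ : Fin (2 * b + 1) => false) = 0 := by simp [wt]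
    have h2 : wt (fun _ : Fin (2 * b + 1) => true) = 2 * b + 1 := by simp [wt]
    beta_reduce
    rw [h1, h2, decide_eq_true (Nat.zero_le b), decide_eq_false (by omega)]
    decide
  · have hdeg : modDeg m (2 * b + 1) (fun x => decide (wt x ≤ b)) ≤ ⌊X * (1 + ε)⌋₊ := by
      refine Finset.sup_le fun S hS => ?_
      by_contra! hlt
      refine (Finset.mem_filter.1 hS).2 ?_
      have hcard : S.card ≤ 2 * b + 1 := by simpa using Finset.card_le_univ S
      have hSX : X * (1 + ε) < S.card := Nat.lt_of_floor_lt hlt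
      have hbS : b < S.card := by
        have : (b : ℝ) < S.card := by nlinarith
        exact_mod_cast this
      obtain ⟨k, hk⟩ := Nat.exists_eq_succ_of_ne_zero (Nat.ne_zero_of_lt hbS)
      rw [modCoeff_threshold m S hk (by omega), ZMod.intCast_zmod_eq_zero_iff_dvd]
      refine Dvd.dvd.mul_left (Dvd.dvd.mul_left (Int.natCast_dvd_natCast.2 ?_) _) _
      rw [← Nat.prod_primeFactors_of_squarefree hsf]
      refine Finset.prod_primes_dvd _ (fun p hp => (Nat.prime_of_mem_primeFactors hp).prime)
        fun p hp => ?_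
      obtain ⟨a, ha1, ha2⟩ := hX p hp
      have hbp : b < p ^ a := by
        have : (b : ℝ) < (p : ℝ) ^ a := by linarith
        exact_mod_cast this
      have hpS : p ^ a < S.card := by
        have : (p : ℝ) ^ a < S.card := by linarith
        exact_mod_cast this
      obtain ⟨r, rfl⟩ : ∃ r, k = p ^ a + r := ⟨k - p ^ a, by omega⟩
      exact (Nat.prime_of_mem_primeFactors hp).dvd_choose_pow_add hbp (by omega)
    have hfloor : (modDeg m (2 * b + 1) (fun x => decide (wt x ≤ b)) : ℝ) ≤ X * (1 + ε) :=
      (Nat.cast_le.2 hdeg).trans (Nat.floor_le (by positivity))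
    refine hfloor.trans ?_
    have h3 : 3 + 6 * ε ≤ X * ε := by
      have := mul_le_mul_of_nonneg_right hXε hε.le
      rwa [add_mul, div_mul_cancel₀ _ hε.ne'] at this
    have h4 : (1 / 2 + ε) * (2 * X - 3) ≤ (1 / 2 + ε) * ((2 * b + 1 : ℕ) : ℝ) :=
      mul_le_mul_of_nonneg_left (by push_cast; linarith) (by linarith)
    linarith
end

section
/- Let p be a prime, t and k positive integers, and set d := (k−1)·φ(p^t) + p^t − 1. Then for every n ≥ d and every integer a with 0 ≤ a < p^t, the function MOD_n^{a,p^t} satisfies deg_{p^k}(MOD_n^{a,p^t}) = d. -/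
/-- The function `MOD_n^{c,M}`, indicating whether the Hamming weight is `≡ c (mod M)`. -/
def MODfn (n c M : ℕ) : (Fin n → Bool) → Bool :=
  fun x => decide (wt x % M = c % M)

open Polynomial in
theorem C_dvd_of_map_zmod_eq_zero {p : ℕ} {f : ℤ[X]}
    (hf : f.map (Int.castRingHom (ZMod p)) = 0) : ∃ u : ℤ[X], f = C (p : ℤ) * u := by
  refine (C_dvd_iff_dvd_coeff _ _).2 fun i => ?_
  have := congrArg (fun g => coeff g i) hf
  rw [← ZMod.intCast_zmod_eq_zero_iff_dvd]
  simpa using this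

open Polynomial in
/-- Frobenius: `X ^ p ^ s - 1` and `(X - 1) ^ p ^ s` differ by a multiple of `p (X - 1)`. -/
theorem exists_X_pow_sub_one_eq {p : ℕ} (hp : p.Prime) (s : ℕ) :
    ∃ g : ℤ[X], X ^ p ^ s - 1 = (X - 1) ^ p ^ s + C (p : ℤ) * (X - 1) * g := by
  have := Fact.mk hp
  obtain ⟨u, hu⟩ := C_dvd_of_map_zmod_eq_zero (p := p)
    (f := X ^ p ^ s - 1 - (X - 1) ^ p ^ s) (by simp [sub_pow_char_pow])
  have h1 : u.IsRoot 1 := by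
    have := congrArg (eval 1) hu
    simpa [hp.ne_zero] using this
  obtain ⟨g, rfl⟩ := dvd_iff_isRoot.2 h1
  refine ⟨g, ?_⟩
  rw [C_1] at hu
  linear_combination hu

open Polynomial in
theorem exists_geom_sum_eq {p : ℕ} (hp : p.Prime) (s r : ℕ) :
    ∃ h : ℤ[X], ∑ i ∈ Finset.range (p ^ r), (X ^ p ^ s) ^ i
      = (X - 1) ^ (p ^ s * (p ^ r - 1)) + C (p : ℤ) * h := by
  have := Fact.mk hp
  obtain ⟨h, hh⟩ := C_dvd_of_map_zmod_eq_zero (p := p)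
    (f := ∑ i ∈ Finset.range (p ^ r), (X ^ p ^ s) ^ i - (X - 1) ^ (p ^ s * (p ^ r - 1))) (by
      have hne : ((X : (ZMod p)[X]) - 1) ^ p ^ s ≠ 0 :=
        pow_ne_zero _ (by simpa using X_sub_C_ne_zero (1 : ZMod p))
      have e : ((X : (ZMod p)[X]) - 1) ^ p ^ s = X ^ p ^ s - 1 := by simp [sub_pow_char_pow]
      have e2 : p ^ s * (p ^ r - 1) + p ^ s = p ^ (s + r) := by
        rw [← Nat.mul_succ, Nat.succ_eq_add_one, Nat.sub_add_cancel (pow_pos hp.pos _), pow_add]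
      simp only [Polynomial.map_sub, Polynomial.map_sum, Polynomial.map_pow, map_X,
        Polynomial.map_one, sub_eq_zero]
      apply mul_right_cancel₀ hne
      rw [← pow_add, e2, e, geom_sum_mul, ← pow_mul, ← pow_add]
      simp [sub_pow_char_pow])
  exact ⟨h, by linear_combination hh⟩

section

variable {R : Type*} [CommRing R]

/-- If `x ^ q - 1` is annihilated by `F = y ^ e + p h`, with `q ≤ e`, then `y ^ (q + k e)` is
divisible by `p ^ k`. -/
theorem pow_dvd_pow_of_annihilator {P y A F g h : R} {q e : ℕ} (hqe : q ≤ e)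
    (hg : A = y ^ q + P * y * g) (hh : F = y ^ e + P * h) (h0 : A * F = 0) (k : ℕ) :
    P ^ k ∣ y ^ (q + k * e) := by
  induction k with
  | zero => simp
  | succ k ih =>
    have hA : A * y ^ ((k + 1) * e) = A * (-(P * h)) ^ (k + 1) := by
      have key : ∀ m, A * (y ^ e) ^ m = A * (-(P * h)) ^ m := by
        intro m
        induction m with
        | zero => simp
        | succ m ihm =>
          rw [pow_succ, pow_succ, ← mul_assoc, ihm]
          linear_combination (-(P * h)) ^ m * (h0 - A * hh)
      rw [mul_comm (k + 1) e, pow_mul, key]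
    obtain ⟨c, hc⟩ : P ^ k ∣ y ^ ((k + 1) * e) :=
      ih.trans (pow_dvd_pow _ (by rw [add_mul]; omega))
    refine ⟨A * (-h) ^ (k + 1) - y * g * c, ?_⟩
    have e1 : (-(P * h)) ^ (k + 1) = P ^ (k + 1) * (-h) ^ (k + 1) := by
      rw [← mul_pow]; ring
    rw [e1] at hA
    rw [pow_add]
    linear_combination hA - y ^ ((k + 1) * e) * hg - P * y * g * hc

theorem pow_mul_dvd_of_annihilator {P y A F g : R} {q : ℕ} (hq : 0 < q)
    (hg : A = y ^ q + P * y * g) (h0 : A * F = 0) (m : ℕ) :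
    P ^ m ∣ y ^ (1 + m * (q - 1)) * F := by
  suffices H : P ^ m * (y * F) ∣ y ^ (1 + m * (q - 1)) * F from (Dvd.intro _ rfl).trans H
  induction m with
  | zero => simp
  | succ m ih =>
    obtain ⟨c, hc⟩ := ih
    obtain ⟨q, rfl⟩ := Nat.exists_eq_succ_of_ne_zero hq.ne'
    simp only [Nat.succ_eq_add_one, Nat.add_sub_cancel] at *
    refine ⟨-(g * c), ?_⟩
    have e : 1 + (m + 1) * q = (1 + m * q) + q := by ring
    rw [e, pow_add]
    linear_combination y ^ q * hc + P ^ m * c * h0 - P ^ m * c * F * hg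

theorem exists_pow_eq_of_annihilator {P y A F N g h b : R} {q e : ℕ} (hq : 0 < q) (hqe : q ≤ e)
    (hg : A = y ^ q + P * y * g) (hh : F = y ^ e + P * h) (h0 : A * F = 0)
    (hhN : h * N = N) (hb : N = y ^ (e + q - 1) + P * b) (k : ℕ) :
    ∃ z, y ^ ((k + 1) * e + q - 1) = (-1) ^ k * P ^ k * N + P ^ (k + 1) * z := by
  induction k with
  | zero => exact ⟨-b, by simp only [zero_add, one_mul]; linear_combination -hb⟩
  | succ k ih =>
    obtain ⟨z, hz⟩ := ih
    obtain ⟨c, hc⟩ : P ^ (k + 2) ∣ y ^ ((k + 1) * e + q - 1) * F := by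
      refine (pow_mul_dvd_of_annihilator hq hg h0 (k + 2)).trans
        (mul_dvd_mul_right (pow_dvd_pow _ ?_) _)
      have := Nat.mul_le_mul_left (k + 1) hqe
      obtain ⟨q, rfl⟩ := Nat.exists_eq_succ_of_ne_zero hq.ne'
      simp only [Nat.succ_eq_add_one, Nat.add_sub_cancel] at *
      have : 1 + (k + 2) * q ≤ (k + 1) * (q + 1) + q := by nlinarith
      omega
    refine ⟨c - h * z, ?_⟩
    have e1 : (k + 1 + 1) * e + q - 1 = ((k + 1) * e + q - 1) + e := by
      rw [add_mul _ 1, one_mul]; omega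
    rw [e1, pow_add]
    linear_combination hc - y ^ ((k + 1) * e + q - 1) * hh - P * h * hz
      - (-1) ^ k * P ^ (k + 1) * hhN

end

/-- The canonical generator of the group ring `ℤ[ℤ/M]`. -/
noncomputable def cyclicGen (M : ℕ) : AddMonoidAlgebra ℤ (ZMod M) :=
  AddMonoidAlgebra.single 1 1

theorem cyclicGen_pow (M j : ℕ) :
    cyclicGen M ^ j = AddMonoidAlgebra.single (j : ZMod M) 1 := by
  simp [cyclicGen, AddMonoidAlgebra.single_pow]

theorem cyclicGen_pow_self (M : ℕ) : cyclicGen M ^ M = 1 := by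
  rw [cyclicGen_pow, ZMod.natCast_self]; rfl

theorem geom_sum_cyclicGen_apply {M a : ℕ} (ha : a < M) :
    (∑ i ∈ Finset.range M, cyclicGen M ^ i).coeff (a : ZMod M) = 1 := by
  rw [AddMonoidAlgebra.coeff_sum, Finsupp.finsetSum_apply,
    Finset.sum_eq_single_of_mem a (Finset.mem_range.2 ha)]
  · simp [cyclicGen_pow]
  · intro j hj hja
    rw [cyclicGen_pow, AddMonoidAlgebra.coeff_single, Finsupp.single_apply, if_neg]
    rw [ZMod.natCast_eq_natCast_iff', Nat.mod_eq_of_lt (Finset.mem_range.1 hj),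
      Nat.mod_eq_of_lt ha]
    exact hja

theorem cyclicGen_sub_one_pow_apply (M a s : ℕ) :
    ((cyclicGen M - 1) ^ s).coeff (a : ZMod M)
      = ∑ j ∈ Finset.range (s + 1),
          (s.choose j : ℤ) * ((-1) ^ (s - j) * if j % M = a % M then 1 else 0) := by
  rw [sub_eq_add_neg, add_pow, AddMonoidAlgebra.coeff_sum, Finsupp.finsetSum_apply]
  refine Finset.sum_congr rfl fun j _ => ?_
  have e : cyclicGen M ^ j * (-1) ^ (s - j) * (s.choose j : AddMonoidAlgebra ℤ (ZMod M))
      = ((s.choose j : ℤ) * (-1) ^ (s - j)) • cyclicGen M ^ j := by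
    rw [zsmul_eq_mul]; push_cast; ring
  rw [e, cyclicGen_pow, AddMonoidAlgebra.coeff_smul, Finsupp.smul_apply,
    AddMonoidAlgebra.coeff_single, Finsupp.single_apply, smul_eq_mul, mul_assoc]
  simp only [ZMod.natCast_eq_natCast_iff']

theorem modCoeff_MODfn (m n a M : ℕ) (S : Finset (Fin n)) :
    modCoeff m n (MODfn n a M) S = (((cyclicGen M - 1) ^ S.card).coeff (a : ZMod M) : ℤ) := by
  rw [cyclicGen_sub_one_pow_apply]
  have h := Finset.sum_powerset_apply_card
    (fun j => (-1 : ZMod m) ^ (S.card - j) * if j % M = a % M then 1 else 0) (x := S)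
  simp only [nsmul_eq_mul] at h
  simpa [modCoeff, MODfn, wt] using h

theorem dvd_coeff_of_natCast_dvd {G : Type*} [AddCommMonoid G] {m : ℕ}
    {f : AddMonoidAlgebra ℤ G} (h : (m : AddMonoidAlgebra ℤ G) ∣ f) (x : G) :
    (m : ℤ) ∣ f.coeff x := by
  obtain ⟨c, rfl⟩ := h
  refine ⟨c.coeff x, ?_⟩
  rw [← nsmul_eq_mul, AddMonoidAlgebra.coeff_smul, Finsupp.smul_apply, nsmul_eq_mul]

open Polynomial in
theorem aeval_mul_of_mul_eq {R : Type*} [CommRing R] {x N : R} (h : x * N = N) (f : ℤ[X]) :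
    aeval x f * N = f.eval 1 * N := by
  obtain ⟨u, hu⟩ := X_sub_C_dvd_sub_C_eval (p := f) (a := 1)
  have := congrArg (aeval x) hu
  simp only [map_sub, map_mul, aeval_X, map_one, eq_intCast, map_intCast] at this
  linear_combination N * this + aeval x u * h

open Polynomial in
/-- With `y = x - 1` and `q = p ^ s`, the powers of `y` in a ring where `x ^ (p q) = 1`. -/
theorem pow_sub_one_of_pow_eq_one {R : Type*} [CommRing R] {p s : ℕ} (hp : p.Prime) {x : R}
    (hx : x ^ p ^ (s + 1) = 1) (k : ℕ) :
    (p : R) ^ k ∣ (x - 1) ^ (p ^ s + k * (p ^ s * (p - 1))) ∧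
    ∃ z, (x - 1) ^ ((k + 1) * (p ^ s * (p - 1)) + p ^ s - 1)
      = (-1) ^ k * p ^ k * ∑ i ∈ Finset.range (p ^ (s + 1)), x ^ i + p ^ (k + 1) * z := by
  obtain ⟨g, hg⟩ := exists_X_pow_sub_one_eq hp s
  obtain ⟨h, hh⟩ := exists_geom_sum_eq hp s 1
  obtain ⟨b, hb⟩ := exists_geom_sum_eq hp 0 (s + 1)
  have hq : 0 < p ^ s := pow_pos hp.pos s
  have hp1 : 0 < p - 1 := Nat.sub_pos_of_lt hp.one_lt
  have hqe : p ^ s ≤ p ^ s * (p - 1) := Nat.le_mul_of_pos_right _ hp1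
  have h1 : h.eval 1 = 1 := by
    have := congrArg (eval 1) hh
    simpa [eval_finsetSum, hq.ne', hp1.ne', hp.ne_zero] using this.symm
  have hexp : p ^ s * (p - 1) + p ^ s - 1 = p ^ (s + 1) - 1 := by
    rw [← Nat.mul_succ, Nat.succ_eq_add_one, Nat.sub_add_cancel hp.pos, pow_succ]
  have hxN : x * ∑ i ∈ Finset.range (p ^ (s + 1)), x ^ i
      = ∑ i ∈ Finset.range (p ^ (s + 1)), x ^ i := by
    have := mul_geom_sum x (p ^ (s + 1))
    rw [hx] at this
    linear_combination this
  have h0 : (x ^ p ^ s - 1) * ∑ i ∈ Finset.range p, (x ^ p ^ s) ^ i = 0 := by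
    rw [mul_geom_sum, ← pow_mul, ← pow_succ, hx, sub_self]
  have hhN := aeval_mul_of_mul_eq hxN h
  rw [h1, Int.cast_one, one_mul] at hhN
  replace hg := congrArg (aeval x) hg
  replace hh := congrArg (aeval x) hh
  replace hb := congrArg (aeval x) hb
  simp only [map_sub, map_add, map_mul, map_sum, map_pow, aeval_X, map_one, map_natCast,
    pow_zero, pow_one, one_mul] at hg hh hb
  rw [← hexp] at hb
  exact ⟨pow_dvd_pow_of_annihilator hqe hg hh h0 k,
    exists_pow_eq_of_annihilator hq hqe hg hh h0 hhN hb k⟩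

/-- For `d := (k−1)φ(p^t) + p^t − 1`, every `n ≥ d` and `0 ≤ a < p^t`,
`deg_{p^k}(MOD_n^{a,p^t}) = d`. -/
theorem stmt7 (p t k n a : ℕ) (hp : p.Prime) (ht : 0 < t) (hk : 0 < k) (ha : a < p ^ t)
    (hn : (k - 1) * Nat.totient (p ^ t) + p ^ t - 1 ≤ n) :
    modDeg (p ^ k) n (MODfn n a (p ^ t)) = (k - 1) * Nat.totient (p ^ t) + p ^ t - 1 := by
  obtain ⟨s, rfl⟩ := Nat.exists_eq_succ_of_ne_zero ht.ne'
  obtain ⟨k, rfl⟩ := Nat.exists_eq_succ_of_ne_zero hk.ne'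
  simp only [Nat.succ_eq_add_one, Nat.add_sub_cancel] at *
  have hd : k * Nat.totient (p ^ (s + 1)) + p ^ (s + 1) - 1
      = (k + 1) * (p ^ s * (p - 1)) + p ^ s - 1 := by
    rw [Nat.totient_prime_pow_succ hp, add_mul, one_mul, add_assoc _ _ (p ^ s), ← Nat.mul_succ,
      Nat.succ_eq_add_one, Nat.sub_add_cancel hp.pos, pow_succ]
  have hq : 0 < p ^ s := pow_pos hp.pos s
  rw [hd] at hn ⊢
  have hx := cyclicGen_pow_self (p ^ (s + 1))
  apply le_antisymm
  · refine Finset.sup_le fun S hS => ?_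
    by_contra! hlt
    refine (Finset.mem_filter.1 hS).2 ?_
    rw [modCoeff_MODfn, ZMod.intCast_zmod_eq_zero_iff_dvd]
    refine dvd_coeff_of_natCast_dvd ?_ _
    rw [Nat.cast_pow]
    exact (pow_sub_one_of_pow_eq_one hp hx (k + 1)).1.trans (pow_dvd_pow _ (by omega))
  · obtain ⟨S, -, hS⟩ := Finset.exists_subset_card_eq (s := (Finset.univ : Finset (Fin n)))
      (n := (k + 1) * (p ^ s * (p - 1)) + p ^ s - 1) (by rwa [Finset.card_univ, Fintype.card_fin])
    refine hS.symm.le.trans (Finset.le_sup (f := Finset.card) (Finset.mem_filter.2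
      ⟨Finset.mem_univ _, ?_⟩))
    obtain ⟨z, hz⟩ := (pow_sub_one_of_pow_eq_one hp hx k).2
    rw [modCoeff_MODfn, hS, Ne, ZMod.intCast_zmod_eq_zero_iff_dvd]
    intro hdvd
    have h1 := dvd_coeff_of_natCast_dvd
      (Dvd.intro z rfl : ((p ^ (k + 1) : ℕ) : AddMonoidAlgebra ℤ (ZMod (p ^ (s + 1)))) ∣ _)
      (a : ZMod (p ^ (s + 1)))
    rw [Nat.cast_pow (α := AddMonoidAlgebra ℤ (ZMod (p ^ (s + 1))))] at h1
    have e : (-1) ^ k * (p : AddMonoidAlgebra ℤ (ZMod (p ^ (s + 1)))) ^ k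
          * ∑ i ∈ Finset.range (p ^ (s + 1)), cyclicGen (p ^ (s + 1)) ^ i
        = ((-1 : ℤ) ^ k * (p : ℤ) ^ k)
          • ∑ i ∈ Finset.range (p ^ (s + 1)), cyclicGen (p ^ (s + 1)) ^ i := by
      rw [zsmul_eq_mul]; push_cast; ring
    rw [hz, AddMonoidAlgebra.coeff_add, Finsupp.add_apply, Int.dvd_add_left h1, e,
      AddMonoidAlgebra.coeff_smul, Finsupp.smul_apply, geom_sum_cyclicGen_apply ha, smul_eq_mul,
      mul_one, ((isUnit_one.neg.pow k).dvd_mul_left), Nat.cast_pow] at hdvd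
    have := (pow_dvd_pow_iff (by exact_mod_cast hp.ne_zero)
      (Nat.prime_iff_prime_int.1 hp).not_isUnit).1 hdvd
    omega
end

section
/- For every positive integer M there exists N such that the following holds: for every non-degenerate Boolean function f : {0,1}^n → {0,1} with n ≥ N, there exist a set S ⊆ [n] with |S| ≥ M and an assignment σ : [n]∖S → {0,1} such that the restriction f|_σ (the function on {0,1}^S obtained by fixing each bit i ∉ S to σ(i)) is a non-trivial symmetric Boolean function. -/
/-- Finite Ramsey theorem for `r`-uniform hypergraphs and two colours. -/
theorem exists_ramsey (r M : ℕ) : ∃ N : ℕ, ∀ {α : Type} [DecidableEq α] (c : Finset α → Bool)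
    (T : Finset α), N ≤ T.card → ∃ S ⊆ T, S.card = M ∧
      ∀ A ⊆ S, ∀ B ⊆ S, A.card = r → B.card = r → c A = c B := by
  induction r generalizing M with
  | zero =>
    refine ⟨M, fun c T hT => ?_⟩
    obtain ⟨S, hS, hc⟩ := Finset.exists_subset_card_eq hT
    refine ⟨S, hS, hc, fun A _ B _ hA hB => ?_⟩
    rw [Finset.card_eq_zero.mp hA, Finset.card_eq_zero.mp hB]
  | succ r ih =>
    have key : ∀ k a b : ℕ, a + b = k → ∃ N : ℕ, ∀ {α : Type} [DecidableEq α]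
        (c : Finset α → Bool) (T : Finset α), N ≤ T.card → ∃ S ⊆ T, ∃ v : Bool,
          S.card = (if v then a else b) ∧ ∀ A ⊆ S, A.card = r + 1 → c A = v := by
      intro k
      induction k with
      | zero =>
        intro a b hab
        refine ⟨0, fun c T _ => ⟨∅, by simp, true, by simp; omega, fun A hA hc => ?_⟩⟩
        simp [Finset.subset_empty.mp hA] at hc
      | succ k ihk =>
        intro a b hab
        rcases Nat.eq_zero_or_pos a with rfl | ha
        · refine ⟨0, fun c T _ => ⟨∅, by simp, true, by simp, fun A hA hc => ?_⟩⟩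
          simp [Finset.subset_empty.mp hA] at hc
        rcases Nat.eq_zero_or_pos b with rfl | hb
        · refine ⟨0, fun c T _ => ⟨∅, by simp, false, by simp, fun A hA hc => ?_⟩⟩
          simp [Finset.subset_empty.mp hA] at hc
        obtain ⟨N₁, h₁⟩ := ihk (a - 1) b (by omega)
        obtain ⟨N₂, h₂⟩ := ihk a (b - 1) (by omega)
        obtain ⟨N, hN⟩ := ih (max N₁ N₂ + r)
        refine ⟨N + 1, fun {α} _ c T hT => ?_⟩
        obtain ⟨x, hx⟩ : T.Nonempty := Finset.card_pos.mp (by omega)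
        obtain ⟨S', hS', hc', hom⟩ := hN (fun A => c (insert x A)) (T.erase x)
          (by rw [Finset.card_erase_of_mem hx]; omega)
        have hxS' : x ∉ S' := fun h => by simpa using hS' h
        have hS'T : S' ⊆ T := hS'.trans (Finset.erase_subset _ _)
        obtain ⟨A₀, hA₀, hA₀c⟩ := Finset.exists_subset_card_eq (show r ≤ S'.card by omega)
        have extend : ∀ S ⊆ S', ∀ v : Bool, c (insert x A₀) = v →
            (∀ A ⊆ S, A.card = r + 1 → c A = v) →
            ∀ A ⊆ insert x S, A.card = r + 1 → c A = v := by
          intro S hS v hv hmono A hA hAc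
          by_cases hxA : x ∈ A
          · have hsub : A.erase x ⊆ S := by rwa [← Finset.subset_insert_iff]
            have := hom (A.erase x) (hsub.trans hS) A₀ hA₀
              (by rw [Finset.card_erase_of_mem hxA]; omega) hA₀c
            simp only [Finset.insert_erase hxA] at this
            rw [this, hv]
          · exact hmono A ((Finset.subset_insert_iff_of_notMem hxA).mp hA) hAc
        cases hv : c (insert x A₀) with
        | true =>
          obtain ⟨S, hS, v, hSc, hmono⟩ := h₁ c S' (by omega)
          cases v with
          | true =>
            refine ⟨insert x S, Finset.insert_subset hx (hS.trans hS'T), true, ?_,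
              extend S hS true hv hmono⟩
            rw [Finset.card_insert_of_notMem fun h => hxS' (hS h)]
            simp at hSc ⊢; omega
          | false => exact ⟨S, hS.trans hS'T, false, by simpa using hSc, hmono⟩
        | false =>
          obtain ⟨S, hS, v, hSc, hmono⟩ := h₂ c S' (by omega)
          cases v with
          | false =>
            refine ⟨insert x S, Finset.insert_subset hx (hS.trans hS'T), false, ?_,
              extend S hS false hv hmono⟩
            rw [Finset.card_insert_of_notMem fun h => hxS' (hS h)]
            simp at hSc ⊢; omega
          | true => exact ⟨S, hS.trans hS'T, true, by simpa using hSc, hmono⟩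
    obtain ⟨N, hN⟩ := key _ M M rfl
    refine ⟨N, fun c T hT => ?_⟩
    obtain ⟨S, hS, v, hSc, hmono⟩ := hN c T hT
    exact ⟨S, hS, by simpa using hSc, fun A hA B hB hAc hBc => by
      rw [hmono A hA hAc, hmono B hB hBc]⟩

/-- Simultaneous Ramsey theorem for all uniformities below `R`. -/
theorem exists_ramsey_lt (R M : ℕ) : ∃ N : ℕ, ∀ {α : Type} [DecidableEq α]
    (c : Finset α → Bool) (T : Finset α), N ≤ T.card → ∃ S ⊆ T, S.card = M ∧
      ∀ A ⊆ S, ∀ B ⊆ S, A.card < R → A.card = B.card → c A = c B := by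
  induction R generalizing M with
  | zero =>
    refine ⟨M, fun c T hT => ?_⟩
    obtain ⟨S, hS, hc⟩ := Finset.exists_subset_card_eq hT
    exact ⟨S, hS, hc, fun A _ B _ hA => absurd hA (Nat.not_lt_zero _)⟩
  | succ R ih =>
    obtain ⟨N₁, h₁⟩ := ih M
    obtain ⟨N₂, h₂⟩ := exists_ramsey R N₁
    refine ⟨N₂, fun c T hT => ?_⟩
    obtain ⟨S₂, hS₂, hc₂, hom₂⟩ := h₂ c T hT
    obtain ⟨S, hS, hc, hom⟩ := h₁ c S₂ hc₂.ge
    refine ⟨S, hS.trans hS₂, hc, fun A hA B hB hAR hAB => ?_⟩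
    rcases Nat.lt_succ_iff_lt_or_eq.mp hAR with h | h
    · exact hom A hA B hB h hAB
    · exact hom₂ A (hA.trans hS) B (hB.trans hS) h (hAB ▸ h)

/-- A nonempty subset of the `n`-cube in which every point has at most `k` neighbours outside
the subset has at least `2 ^ (n - k)` points. -/
theorem two_pow_le_card_mul_two_pow (n k : ℕ) (p : (Fin n → Bool) → Prop) [DecidablePred p]
    (hne : ∃ x, p x)
    (hdeg : ∀ x, p x →
      (Finset.univ.filter fun j => ¬ p (Function.update x j (!x j))).card ≤ k) :
    2 ^ n ≤ (Finset.univ.filter p).card * 2 ^ k := by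
  induction n generalizing k with
  | zero =>
    obtain ⟨x, hx⟩ := hne
    have h1 : 0 < (Finset.univ.filter p).card := Finset.card_pos.mpr ⟨x, Finset.mem_filter.mpr ⟨Finset.mem_univ x, hx⟩⟩
    simpa using Nat.mul_le_mul h1 (Nat.one_le_two_pow (n := k))
  | succ n ih =>
    let q (b : Bool) (x : Fin n → Bool) : Prop := p (Fin.cons b x)
    have hcard : (Finset.univ.filter p).card =
        (Finset.univ.filter (q true)).card + (Finset.univ.filter (q false)).card := by
      simp only [Finset.card_filter]
      rw [← (Fin.consEquiv fun _ : Fin (n + 1) => Bool).sum_comp, Fintype.sum_prod_type]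
      simp only [Fin.consEquiv, Fintype.sum_bool, q]
      rfl
    have hsplit : ∀ b (x : Fin n → Bool),
        (Finset.univ.filter fun j => ¬ p (Function.update (Fin.cons b x : Fin (n + 1) → Bool) j
          (!(Fin.cons b x : Fin (n + 1) → Bool) j))).card =
        (if q (!b) x then 0 else 1) +
          (Finset.univ.filter fun j => ¬ q b (Function.update x j (!x j))).card := by
      intro b x
      rw [Finset.card_filter, Finset.card_filter, Fin.sum_univ_succ]
      simp [q, Fin.cons_update, ite_not]
    have hboth : ∀ b, (∃ x, q b x) → 2 ^ n ≤ (Finset.univ.filter (q b)).card * 2 ^ k := by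
      intro b hb
      refine ih k (q b) hb fun x hx => ?_
      have := hdeg _ hx
      rw [hsplit] at this
      omega
    have hone : ∀ b, (∃ x, q b x) → (¬ ∃ x, q (!b) x) →
        2 ^ (n + 1) ≤ (Finset.univ.filter (q b)).card * 2 ^ k := by
      intro b hb hnb
      have hk : ∀ x, q b x → 1 +
          (Finset.univ.filter fun j => ¬ q b (Function.update x j (!x j))).card ≤ k := by
        intro x hx
        have := hdeg _ hx
        rwa [hsplit, if_neg fun h => hnb ⟨x, h⟩] at this
      obtain ⟨x, hx⟩ := hb
      obtain ⟨l, rfl⟩ : ∃ l, k = l + 1 := ⟨k - 1, by have := hk x hx; omega⟩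
      have := ih l (q b) ⟨x, hx⟩ fun y hy => by have := hk y hy; omega
      rw [pow_succ, pow_succ, ← mul_assoc]
      exact Nat.mul_le_mul_right 2 this
    rw [hcard]
    by_cases ht : ∃ x, q true x
    · by_cases hf : ∃ x, q false x
      · have h1 := hboth true ht
        have h2 := hboth false hf
        rw [add_mul, pow_succ]
        omega
      · have := hone true ht hf
        rw [add_mul]
        omega
    · have hf : ∃ x, q false x := by
        obtain ⟨x, hx⟩ := hne
        rw [← Fin.cons_self_tail x] at hx
        cases h0 : x 0 with
        | true => exact absurd ⟨Fin.tail x, by rwa [h0] at hx⟩ ht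
        | false => exact ⟨Fin.tail x, by rwa [h0] at hx⟩
      have := hone false hf ht
      rw [add_mul]
      omega

/-- Simon's theorem: a non-degenerate function of sensitivity at most `s` has at most
`s * 2 ^ (s + s)` variables. -/
theorem NondegenerateBF.le_of_sensitivity_le {n s : ℕ} {f : (Fin n → Bool) → Bool}
    (hf : NondegenerateBF f)
    (hs : ∀ x, (Finset.univ.filter fun i => f x ≠ f (Function.update x i (!x i))).card ≤ s) :
    n ≤ s * 2 ^ (s + s) := by
  have hE : ∀ i, 2 ^ n ≤
      (Finset.univ.filter fun x => f x ≠ f (Function.update x i (!x i))).card * 2 ^ (s + s) := by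
    intro i
    refine two_pow_le_card_mul_two_pow n (s + s) _ (hf i) fun x hx => ?_
    refine (Finset.card_le_card ?_).trans ((Finset.card_union_le _ _).trans
      (Nat.add_le_add (hs x) (hs (Function.update x i (!x i)))))
    intro j hj
    simp only [Finset.mem_filter, Finset.mem_univ, true_and, Finset.mem_union] at hj ⊢
    by_contra! hcon
    apply hj
    have hcomm : Function.update (Function.update x j (!x j)) i
          (!(Function.update x j (!x j)) i) =
        Function.update (Function.update x i (!x i)) j (!(Function.update x i (!x i)) j) := by
      rcases eq_or_ne i j with rfl | hij
      · rfl
      · rw [Function.update_of_ne hij, Function.update_of_ne hij.symm,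
          Function.update_comm hij.symm]
    rw [hcomm, ← hcon.1, ← hcon.2]
    exact hx
  have hcount : ∑ i : Fin n,
      (Finset.univ.filter fun x => f x ≠ f (Function.update x i (!x i))).card ≤ 2 ^ n * s := by
    simp only [Finset.card_filter]
    rw [Finset.sum_comm]
    simp only [← Finset.card_filter]
    refine (Finset.sum_le_card_nsmul _ _ s fun x _ => hs x).trans ?_
    simp
  have h : n * 2 ^ n ≤ 2 ^ n * s * 2 ^ (s + s) := by
    calc n * 2 ^ n = ∑ _i : Fin n, 2 ^ n := by simp
      _ ≤ _ := Finset.sum_le_sum fun i _ => hE i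
      _ = _ := (Finset.sum_mul _ _ _).symm
      _ ≤ _ := Nat.mul_le_mul_right _ hcount
  rw [mul_comm n, mul_assoc] at h
  exact Nat.le_of_mul_le_mul_left h (by positivity)

/-- For every `M` there is `N` such that in every non-degenerate Boolean
function on `n ≥ N` variables one can fix the bits outside some set `S` of at least `M`
coordinates so that the resulting restriction is a non-trivial symmetric function. -/
theorem stmt9 (M : ℕ) (hM : 0 < M) :
    ∃ N : ℕ, ∀ n : ℕ, N ≤ n → ∀ f : (Fin n → Bool) → Bool, NondegenerateBF f →
      ∃ (S : Finset (Fin n)) (σ : Fin n → Bool), M ≤ S.card ∧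
        (∀ y z : {i // i ∈ S} → Bool,
            (Finset.univ.filter fun i => y i = true).card =
              (Finset.univ.filter fun i => z i = true).card →
            f (fun i => if h : i ∈ S then y ⟨i, h⟩ else σ i) =
              f (fun i => if h : i ∈ S then z ⟨i, h⟩ else σ i)) ∧
        (∃ y z : {i // i ∈ S} → Bool,
            f (fun i => if h : i ∈ S then y ⟨i, h⟩ else σ i) ≠
              f (fun i => if h : i ∈ S then z ⟨i, h⟩ else σ i)) := by
  obtain ⟨N, hN⟩ := exists_ramsey_lt (M + 1) M
  refine ⟨(N + N) * 2 ^ (N + N + (N + N)) + 1, fun n hn f hf => ?_⟩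
  obtain ⟨x, hx⟩ : ∃ x, N + N <
      (Finset.univ.filter fun i => f x ≠ f (Function.update x i (!x i))).card := by
    by_contra! hcon
    have := hf.le_of_sensitivity_le hcon
    omega
  obtain ⟨b, hb⟩ : ∃ b, N ≤ (Finset.univ.filter fun i =>
      f x ≠ f (Function.update x i (!x i)) ∧ x i = b).card := by
    by_contra! hcon
    have h := Finset.card_filter_add_card_filter_not
      (s := Finset.univ.filter fun i => f x ≠ f (Function.update x i (!x i))) (fun i => x i = true)
    simp only [Finset.filter_filter, Bool.not_eq_true] at h
    have h1 := hcon true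
    have h2 := hcon false
    omega
  obtain ⟨S, hST, hSc, hom⟩ := hN (fun A => f fun i => if i ∈ A then !x i else x i) _ hb
  have hS : ∀ i ∈ S, f x ≠ f (Function.update x i (!x i)) ∧ x i = b := fun i hi => by
    simpa using hST hi
  have hflip : ∀ y : {i // i ∈ S} → Bool,
      (fun i => if h : i ∈ S then y ⟨i, h⟩ else x i) = fun i =>
        if i ∈ (Finset.univ.filter fun j => y j = !b).map (Function.Embedding.subtype _)
        then !x i else x i := by
    intro y
    funext i
    by_cases hi : i ∈ S
    · have hxi := (hS i hi).2
      cases hy : y ⟨i, hi⟩ <;> cases b <;> simp [hi, hy, hxi]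
    · simp [hi]
  have hsub : ∀ y : {i // i ∈ S} → Bool,
      (Finset.univ.filter fun j => y j = !b).map (Function.Embedding.subtype _) ⊆ S := by
    intro y i hi
    simp only [Finset.mem_map, Function.Embedding.subtype_apply] at hi
    obtain ⟨j, _, rfl⟩ := hi
    exact j.2
  refine ⟨S, x, hSc.ge, fun y z hyz => ?_, ?_⟩
  · rw [hflip y, hflip z]
    refine hom _ (hsub y) _ (hsub z) ?_ ?_
    · have := Finset.card_le_card (hsub y)
      omega
    · rw [Finset.card_map, Finset.card_map]
      cases b with
      | false => exact hyz
      | true =>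
        have h1 := Finset.card_filter_add_card_filter_not (s := Finset.univ) (fun i => y i = true)
        have h2 := Finset.card_filter_add_card_filter_not (s := Finset.univ) (fun i => z i = true)
        simp only [Bool.not_eq_true] at h1 h2
        simp only [Bool.not_true]
        omega
  · obtain ⟨i, hi⟩ : S.Nonempty := Finset.card_pos.mp (by omega)
    refine ⟨fun j => x j, fun j => Function.update x i (!x i) j, ?_⟩
    convert (hS i hi).1 using 2
    · simp
    · funext j
      by_cases hj : j ∈ S
      · simp [hj]
      · have hji : j ≠ i := fun h => hj (h ▸ hi)
        simp [hj, hji]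
end

section
/- Let p be a prime and n a positive integer with n < p − 1. Let A_p be the p × p matrix over 𝔽_p with entries (A_p)_{ℓ,j} = binom(p−1−j, p−1−ℓ) mod p for 0 ≤ ℓ, j ≤ p−1. Then for every vector v ∈ {0,1}^p such that v_i ≠ v_j for some 0 ≤ i < j ≤ n, there exists ℓ with ⌊n/2⌋ + 1 ≤ ℓ ≤ n such that (A_p v)_ℓ ≠ 0 in 𝔽_p. -/
open Polynomial in
/-- Over a field, a polynomial of degree `d` taking only the values `0` and `1` on more than `2 * d`
points is constant on these points. -/
lemma eval_eq_eval_of_zero_or_one {K : Type*} [Field K] (f : K[X]) (s : Finset K)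
    (hs : 2 * f.natDegree < s.card) (hf : ∀ x ∈ s, f.eval x = 0 ∨ f.eval x = 1)
    {x y : K} : f.eval x = f.eval y := by
  have h0 : f * (f - 1) = 0 := by
    refine eq_zero_of_natDegree_lt_card_of_eval_eq_zero' _ s ?_ ?_
    · intro z hz
      rcases hf z hz with h | h <;> simp [h]
    · have h1 : (f - 1).natDegree ≤ f.natDegree := by
        simpa using natDegree_sub_le f 1
      have h2 := natDegree_mul_le (p := f) (q := f - 1)
      omega
  rcases mul_eq_zero.mp h0 with h | h
  · simp [h]
  · simp [sub_eq_zero.mp h]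

/-- For a prime `p` and `j ≤ ℓ < p`, `binom (p - 1 - j) (p - 1 - ℓ)` is congruent to
`(-1) ^ (ℓ - j) * binom ℓ j` modulo `p`. -/
lemma cast_choose_prime_sub {p : ℕ} [Fact p.Prime] {ℓ j : ℕ} (hj : j ≤ ℓ) (hℓ : ℓ < p) :
    (((p - 1 - j).choose (p - 1 - ℓ) : ℕ) : ZMod p) = (-1) ^ (ℓ - j) * (ℓ.choose j : ZMod p) := by
  obtain ⟨k, rfl⟩ := Nat.exists_eq_add_of_le hj
  have hk : ((k.factorial : ℕ) : ZMod p) ≠ 0 := by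
    rw [Ne, ZMod.natCast_eq_zero_iff, (Fact.out : p.Prime).dvd_factorial]
    omega
  have hsymm : (p - 1 - j).choose (p - 1 - (j + k)) = (p - 1 - j).choose k :=
    Nat.choose_symm_of_eq_add (by omega)
  have hcast : (((p - 1 - j : ℕ)) : ZMod p) = -((j + 1 : ℕ) : ZMod p) := by
    rw [eq_neg_iff_add_eq_zero, ← Nat.cast_add, show p - 1 - j + (j + 1) = p by omega,
      ZMod.natCast_self]
  have hpoch := ascPochhammer_eval_neg_eq_descPochhammer (ZMod p) ((p - 1 - j : ℕ) : ZMod p) k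
  rw [descPochhammer_eval_eq_descFactorial, Nat.descFactorial_eq_factorial_mul_choose, hcast,
    neg_neg, ← ascPochhammer_eval_cast, ascPochhammer_nat_eq_ascFactorial,
    Nat.ascFactorial_eq_factorial_mul_choose] at hpoch
  rw [hsymm, Nat.add_sub_cancel_left, Nat.choose_symm_add]
  apply mul_left_cancel₀ hk
  have hsq : ((-1 : ZMod p) ^ k) * (-1) ^ k = 1 := by rw [← mul_pow]; simp
  push_cast at hpoch ⊢
  linear_combination
    (-(k.factorial : ZMod p) * ((p - 1 - j).choose k : ZMod p)) * hsq - (-1) ^ k * hpoch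

open Polynomial in
/-- If all forward differences at `0` of orders between `d + 1` and `n` vanish, the function agrees
on `{0, …, n}` with a polynomial of degree at most `d`. -/
lemma exists_polynomial_of_fwdDiff_iter_eq_zero {K : Type*} [Field K] (F : ℕ → K) {d n : ℕ}
    (hd : ∀ k ≤ d, (k.factorial : K) ≠ 0)
    (hF : ∀ k, d < k → k ≤ n → (fwdDiff 1)^[k] F 0 = 0) :
    ∃ f : K[X], f.natDegree ≤ d ∧ ∀ x ≤ n, f.eval (x : K) = F x := by
  refine ⟨∑ k ∈ Finset.range (d + 1),
    C ((fwdDiff 1)^[k] F 0 / (k.factorial : K)) * descPochhammer K k, ?_, ?_⟩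
  · refine natDegree_sum_le_of_forall_le _ _ fun k hk => (natDegree_C_mul_le _ _).trans ?_
    rw [descPochhammer_natDegree]
    exact Finset.mem_range_succ_iff.mp hk
  · intro x hx
    have hshift := shift_eq_sum_fwdDiff_iter 1 F x 0
    simp only [smul_eq_mul, mul_one, zero_add, nsmul_eq_mul] at hshift
    have hterm : ∀ k ∈ Finset.range (d + 1),
        (C ((fwdDiff 1)^[k] F 0 / (k.factorial : K)) * descPochhammer K k).eval (x : K) =
          (x.choose k : K) * (fwdDiff 1)^[k] F 0 := by
      intro k hk
      have := hd k (Finset.mem_range_succ_iff.mp hk)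
      rw [eval_mul, eval_C, descPochhammer_eval_eq_descFactorial,
        Nat.descFactorial_eq_factorial_mul_choose]
      push_cast
      field_simp
    rw [eval_finsetSum, Finset.sum_congr rfl hterm, hshift]
    rcases le_total d x with h | h
    · refine Finset.sum_subset (Finset.range_mono (by omega)) fun k hk hk' => ?_
      simp only [Finset.mem_range, not_lt] at hk hk'
      rw [hF k (by omega) (by omega), mul_zero]
    · refine (Finset.sum_subset (Finset.range_mono (by omega)) fun k _ hk' => ?_).symm
      simp only [Finset.mem_range, not_lt] at hk'
      rw [Nat.choose_eq_zero_of_lt (by omega), Nat.cast_zero, zero_mul]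

/-- The matrix with entries `binom (p - 1 - j) (p - 1 - ℓ)` computes forward differences at `0`. -/
lemma sum_choose_mul_eq_fwdDiff_iter {p : ℕ} [Fact p.Prime] (F : ℕ → ZMod p) {ℓ : ℕ} (hℓ : ℓ < p) :
    ∑ r : Fin p, (((p - 1 - (r : ℕ)).choose (p - 1 - ℓ) : ℕ) : ZMod p) * F r =
      (fwdDiff 1)^[ℓ] F 0 := by
  rw [Fin.sum_univ_eq_sum_range
    (fun r => (((p - 1 - r).choose (p - 1 - ℓ) : ℕ) : ZMod p) * F r) p, fwdDiff_iter_eq_sum_shift]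
  symm
  apply Finset.sum_subset_zero_on_sdiff (Finset.range_mono (by omega : ℓ + 1 ≤ p))
  · intro r hr
    simp only [Finset.mem_sdiff, Finset.mem_range, not_lt] at hr
    rw [Nat.choose_eq_zero_of_lt (by omega), Nat.cast_zero, zero_mul]
  · intro r hr
    rw [cast_choose_prime_sub (Finset.mem_range_succ_iff.mp hr) hℓ]
    simp [zsmul_eq_mul]

/-- Let `A_p` be the `p × p` matrix over `𝔽_p` with entries
`binom(p−1−j, p−1−ℓ)`. For `0 < n < p − 1` and any 0/1 vector `v` that is not constant on its
first `n+1` entries, some coordinate `ℓ ∈ [⌊n/2⌋+1, n]` of `A_p v` is nonzero. -/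
theorem stmt12 (p n : ℕ) (hp : p.Prime) (hn : 0 < n) (hnp : n < p - 1)
    (A : Matrix (Fin p) (Fin p) (ZMod p))
    (hA : ∀ ℓ j : Fin p, A ℓ j = ((Nat.choose (p - 1 - (j : ℕ)) (p - 1 - (ℓ : ℕ)) : ℕ) : ZMod p))
    (v : Fin p → Bool) (i j : Fin p) (hij : i < j) (hjn : (j : ℕ) ≤ n) (hv : v i ≠ v j) :
    ∃ ℓ : Fin p, n / 2 + 1 ≤ (ℓ : ℕ) ∧ (ℓ : ℕ) ≤ n ∧
      A.mulVec (fun r => if v r then 1 else 0) ℓ ≠ 0 := by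
  have : Fact p.Prime := ⟨hp⟩
  by_contra! hzero
  let F : ℕ → ZMod p := fun k => if h : k < p then (if v ⟨k, h⟩ then 1 else 0) else 0
  have hFv (r : Fin p) : F r = if v r then 1 else 0 := by simp [F]
  have hF01 (k : ℕ) : F k = 0 ∨ F k = 1 := by
    simp only [F]
    split_ifs <;> simp
  obtain ⟨f, hdeg, hf⟩ := exists_polynomial_of_fwdDiff_iter_eq_zero F (d := n / 2) (n := n)
    (fun k hk => by
      rw [Ne, ZMod.natCast_eq_zero_iff, hp.dvd_factorial]
      omega)
    (fun k hk hkn => by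
      have h := hzero ⟨k, by omega⟩ hk hkn
      rw [← sum_choose_mul_eq_fwdDiff_iter F (by omega : k < p), ← h]
      simp [Matrix.mulVec, dotProduct, hA, hFv])
  have hinj : Set.InjOn (Nat.cast : ℕ → ZMod p) (Finset.range (n + 1)) := fun a ha b hb hab => by
    simp only [Finset.coe_range, Set.mem_Iio] at ha hb
    rw [ZMod.natCast_eq_natCast_iff] at hab
    exact hab.eq_of_lt_of_lt (by omega) (by omega)
  have hconst : f.eval ((i : ℕ) : ZMod p) = f.eval ((j : ℕ) : ZMod p) := by
    refine eval_eq_eval_of_zero_or_one f ((Finset.range (n + 1)).image Nat.cast) ?_ ?_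
    · rw [Finset.card_image_of_injOn hinj, Finset.card_range]
      omega
    · intro x hx
      obtain ⟨k, hk, rfl⟩ := Finset.mem_image.mp hx
      rw [hf k (Finset.mem_range_succ_iff.mp hk)]
      exact hF01 k
  rw [hf i (by have : (i : ℕ) < j := hij
               omega), hf j hjn, hFv, hFv] at hconst
  cases hi : v i <;> cases hj : v j <;> simp_all
end

section
/- Let p be a prime and j, k nonnegative integers with j + k < p. Let a_0, ..., a_k be pairwise distinct integers with j ≤ a_s ≤ p − 1 for each s. Then the (k+1) × (k+1) matrix over 𝔽_p whose (i, s)-entry is binom(a_s, j+i) mod p (for 0 ≤ i, s ≤ k) is invertible over 𝔽_p. -/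
/-- Up to row and column scalings, a binomial matrix is a Vandermonde matrix. -/
theorem prod_factorial_mul_det_choose (R : Type*) [CommRing R] [IsDomain R] {n : ℕ} (j : ℕ)
    (a : Fin n → ℕ) :
    (∏ i : Fin n, ((j + (i : ℕ)).factorial : R)) *
        (Matrix.of fun i s : Fin n => ((a s).choose (j + (i : ℕ)) : R)).det =
      (∏ s, ((a s).descFactorial j : R)) *
        (Matrix.vandermonde fun s => ((a s - j : ℕ) : R)).det := by
  rw [Matrix.det_eval_matrixOfPolynomials_eq_det_vandermonde _
      (fun i : Fin n => descPochhammer R i) (fun i => descPochhammer_natDegree R i)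
      (fun i => monic_descPochhammer R i), ← Matrix.det_transpose (Matrix.of fun s i : Fin n =>
      (descPochhammer R i).eval ((a s - j : ℕ) : R)),
    ← Matrix.det_mul_column, ← Matrix.det_mul_row]
  congr 1
  ext i s
  simp only [Matrix.of_apply, Matrix.transpose_apply, descPochhammer_eval_eq_descFactorial]
  norm_cast
  rw [← Nat.descFactorial_eq_factorial_mul_choose,
    ← Nat.descFactorial_mul_descFactorial (Nat.le_add_right j i), Nat.add_sub_cancel_left,
    mul_comm]

/-- For a prime `p`, `j + k < p`, and distinct `a_0, …, a_k` with
`j ≤ a_s ≤ p − 1`, the matrix with entries `binom(a_s, j+i) mod p` is invertible over `𝔽_p`. -/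
theorem stmt13 (p j k : ℕ) (hp : p.Prime) (hjk : j + k < p)
    (a : Fin (k + 1) → ℕ) (hinj : Function.Injective a)
    (ha : ∀ s, j ≤ a s ∧ a s ≤ p - 1)
    (B : Matrix (Fin (k + 1)) (Fin (k + 1)) (ZMod p))
    (hB : ∀ i s : Fin (k + 1), B i s = ((Nat.choose (a s) (j + (i : ℕ)) : ℕ) : ZMod p)) :
    IsUnit B := by
  have : Fact p.Prime := ⟨hp⟩
  have hB' : B = Matrix.of fun i s : Fin (k + 1) => ((a s).choose (j + (i : ℕ)) : ZMod p) := by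
    ext i s
    exact hB i s
  have hlt : ∀ s, a s < p := fun s => by
    have := hp.pos
    have := (ha s).2
    omega
  rw [Matrix.isUnit_iff_isUnit_det, isUnit_iff_ne_zero, hB']
  refine right_ne_zero_of_mul (a := ∏ i : Fin (k + 1), ((j + (i : ℕ)).factorial : ZMod p)) ?_
  rw [prod_factorial_mul_det_choose (ZMod p) j a]
  refine mul_ne_zero (Finset.prod_ne_zero_iff.mpr fun s _ h => ?_)
    (Matrix.det_vandermonde_ne_zero_iff.mpr fun s t h => hinj ?_)
  · rw [ZMod.natCast_eq_zero_iff] at h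
    have hdvd : p ∣ (a s).factorial :=
      h.trans (Dvd.intro_left _ (Nat.factorial_mul_descFactorial (ha s).1))
    exact absurd (hp.dvd_factorial.mp hdvd) (hlt s).not_ge
  · rw [ZMod.natCast_eq_natCast_iff', Nat.mod_eq_of_lt ((Nat.sub_le _ _).trans_lt (hlt s)),
      Nat.mod_eq_of_lt ((Nat.sub_le _ _).trans_lt (hlt t))] at h
    have := (ha s).1
    have := (ha t).1
    omega
end

section
/- Let p be a prime, t a positive integer, and j an integer with 0 ≤ j < p^t. Then for every nonnegative integer w, Σ_{i=0}^{p^t−1} binom(p^t−1−j, p^t−1−i) · binom(w, i) = binom(p^t−1−j+w, p^t−1), and this quantity is congruent modulo p to 1 if w ≡ j (mod p^t) and to 0 otherwise. -/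
/-- Modulo a prime `p`, `n.choose (p ^ t - 1)` is the indicator of `p ^ t ∣ n + 1`. -/
theorem choose_prime_pow_sub_one_cast (p t n : ℕ) [hp : Fact p.Prime] :
    (n.choose (p ^ t - 1) : ZMod p) = if p ^ t ∣ n + 1 then 1 else 0 := by
  induction t generalizing n with
  | zero => simp
  | succ t ih =>
    have hpos : 0 < p := hp.out.pos
    have hk : p ^ (t + 1) - 1 = (p - 1) + p * (p ^ t - 1) := by
      have h : p ≤ p * p ^ t := Nat.le_mul_of_pos_right p (pow_pos hpos t)
      rw [pow_succ', Nat.mul_sub, mul_one]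
      omega
    have hlt : p - 1 < p := Nat.sub_lt hpos one_pos
    have hmod : (p ^ (t + 1) - 1) % p = p - 1 := by
      rw [hk, Nat.add_mul_mod_self_left, Nat.mod_eq_of_lt hlt]
    have hdiv : (p ^ (t + 1) - 1) / p = p ^ t - 1 := by
      rw [hk, Nat.add_mul_div_left _ _ hpos, Nat.div_eq_of_lt hlt, zero_add]
    have hlucas := (ZMod.natCast_eq_natCast_iff _ _ p).2
      (Choose.choose_modEq_choose_mod_mul_choose_div_nat (p := p) (n := n) (k := p ^ (t + 1) - 1))
    rw [hlucas, hmod, hdiv, Nat.cast_mul, ih]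
    have hn := Nat.mod_add_div n p
    have hnp : n % p < p := Nat.mod_lt n hpos
    by_cases h : n % p = p - 1
    · have hsucc : n + 1 = p * (n / p + 1) := by
        rw [mul_add, mul_one]
        omega
      rw [h, Nat.choose_self, Nat.cast_one, one_mul, hsucc, pow_succ']
      exact if_congr (Nat.mul_dvd_mul_iff_left hpos).symm rfl rfl
    · have hndvd : ¬ p ^ (t + 1) ∣ n + 1 := by
        intro hdvd
        have hp1 : p ∣ n + 1 := (dvd_pow_self p t.succ_ne_zero).trans hdvd
        have hp2 : p ∣ n % p + 1 := by
          rw [← hn, add_right_comm] at hp1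
          exact (Nat.dvd_add_left (dvd_mul_right p _)).1 hp1
        have := Nat.le_of_dvd (Nat.succ_pos _) hp2
        omega
      rw [Nat.choose_eq_zero_of_lt (by omega), Nat.cast_zero, zero_mul, if_neg hndvd]

/-- Vandermonde convolution for the `MOD` Mahler coefficients:
`Σ_i binom(p^t−1−j, p^t−1−i)·binom(w, i) = binom(p^t−1−j+w, p^t−1)`, which modulo `p` is the
indicator of `w ≡ j (mod p^t)`. -/
theorem stmt17 (p t j : ℕ) (hp : p.Prime) (ht : 0 < t) (hj : j < p ^ t) (w : ℕ) :
    (∑ i ∈ Finset.range (p ^ t),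
        Nat.choose (p ^ t - 1 - j) (p ^ t - 1 - i) * Nat.choose w i) =
      Nat.choose (p ^ t - 1 - j + w) (p ^ t - 1) ∧
    ((Nat.choose (p ^ t - 1 - j + w) (p ^ t - 1) : ZMod p) =
      if w % p ^ t = j % p ^ t then 1 else 0) := by
  have : Fact p.Prime := ⟨hp⟩
  have hq : 0 < p ^ t := pow_pos hp.pos t
  refine ⟨?_, ?_⟩
  · rw [add_comm, Nat.add_choose_eq, Finset.Nat.sum_antidiagonal_eq_sum_range_succ_mk,
      Nat.succ_eq_add_one, Nat.sub_add_cancel hq]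
    exact Finset.sum_congr rfl fun i _ => mul_comm _ _
  · rw [choose_prime_pow_sub_one_cast]
    refine if_congr ?_ rfl rfl
    rw [← Nat.modEq_zero_iff_dvd]
    have hsum : p ^ t - 1 - j + w + 1 + j = w + p ^ t := by omega
    rw [← Nat.ModEq.rfl.add_iff_right (c := j), hsum, zero_add, Nat.ModEq,
      Nat.add_mod_right]
end
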